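/- arXiv:2105.04856 — 11 statements merged into one kernel-verified Lean document; each statement's English description precedes it below -/
import Mathlib

section
/- Let ℓ ∈ ℕ, let F be a family of finite subsets of some set, and let S₁, S₂, S₃ ∈ F satisfy |Sᵢ Δ Sⱼ| ≥ 2ℓ for all distinct i, j ∈ {1,2,3}. Then {S₁, S₂, S₃} is an ℓ-diverse representative of F. -/
/-- `Fhat` is an `ℓ`-diverse representative of the family `F` of finite sets:
`Fhat ⊆ F` and for every `S ∈ F` and all finite sets `A, B` with
`min (|A Δ S|, |B Δ S|) ≥ ℓ` there is `Ŝ ∈ Fhat` with `min (|A Δ Ŝ|, |B Δ Ŝ|) ≥ ℓ`. -/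
def IsDiverseRep {α : Type*} [DecidableEq α] (ℓ : ℕ) (F Fhat : Set (Finset α)) : Prop :=
  Fhat ⊆ F ∧ ∀ S ∈ F, ∀ A B : Finset α,
    ℓ ≤ (symmDiff A S).card → ℓ ≤ (symmDiff B S).card →
    ∃ Shat ∈ Fhat, ℓ ≤ (symmDiff A Shat).card ∧ ℓ ≤ (symmDiff B Shat).card

/-- Triangle inequality for the Hamming distance `|A Δ B|` on finite sets. -/
theorem card_symmDiff_le_add {α : Type*} [DecidableEq α] (A B C : Finset α) :
    (symmDiff B C).card ≤ (symmDiff A B).card + (symmDiff A C).card := by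
  refine (Finset.card_le_card ?_).trans (Finset.card_union_le _ _)
  rw [symmDiff_comm A B]
  exact symmDiff_triangle B A C

theorem three_far_apart_solutions_form_diverse_representative
    {α : Type*} [DecidableEq α] (ℓ : ℕ) (F : Set (Finset α)) (S₁ S₂ S₃ : Finset α)
    (h₁ : S₁ ∈ F) (h₂ : S₂ ∈ F) (h₃ : S₃ ∈ F)
    (h₁₂ : 2 * ℓ ≤ (symmDiff S₁ S₂).card)
    (h₁₃ : 2 * ℓ ≤ (symmDiff S₁ S₃).card)
    (h₂₃ : 2 * ℓ ≤ (symmDiff S₂ S₃).card) :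
    IsDiverseRep ℓ F {S₁, S₂, S₃} := by
  refine ⟨?_, fun S _ A B _ _ => ?_⟩
  · rintro T (rfl | rfl | rfl) <;> assumption
  have hA₁₂ := card_symmDiff_le_add A S₁ S₂
  have hA₁₃ := card_symmDiff_le_add A S₁ S₃
  have hA₂₃ := card_symmDiff_le_add A S₂ S₃
  have hB₁₂ := card_symmDiff_le_add B S₁ S₂
  have hB₁₃ := card_symmDiff_le_add B S₁ S₃
  have hB₂₃ := card_symmDiff_le_add B S₂ S₃
  simp only [Set.mem_insert_iff, Set.mem_singleton_iff, exists_eq_or_imp, exists_eq_left]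
  omega
end

section
/- Let B₀ be a finite set, c : B₀ → {1,2} a coloring, and M, S, Ŝ ⊆ B₀. Define F′₁ := c⁻¹(1) ∩ M, F′₂ := c⁻¹(2) ∩ M, F′₃ := c⁻¹(1) \ M, F′₄ := c⁻¹(2) \ M. If |Ŝ ∩ F′ᵢ| = |S ∩ F′ᵢ| for all i ∈ {1,2,3,4}, then (i) |Ŝ Δ M| = |S Δ M|, and (ii) for every set A with S \ A ⊆ c⁻¹(1) and A \ S ⊆ c⁻¹(2) one has |A Δ Ŝ| ≥ |A Δ S|. -/
theorem Finset.card_symmDiff_eq_add {α : Type*} [DecidableEq α] (s t : Finset α) :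
    (symmDiff s t).card = (s \ t).card + (t \ s).card :=
  Finset.card_union_of_disjoint disjoint_sdiff_sdiff

theorem Finset.card_eq_card_inter_color_add {α : Type*} [DecidableEq α] {B : Finset α}
    (c : α → Fin 2) {X : Finset α} (hX : X ⊆ B) :
    X.card = (X ∩ B.filter fun x => c x = 0).card + (X ∩ B.filter fun x => c x = 1).card := by
  rw [← Finset.card_union_of_disjoint]
  · congr 1
    ext x
    have := @hX x
    have : c x = 0 ∨ c x = 1 := by omega
    simp only [Finset.mem_union, Finset.mem_inter, Finset.mem_filter]
    tauto
  · rw [Finset.disjoint_left]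
    intro x hx hx'
    simp_all

/-- two-colored count-preserving exchange keeps the distance to `M`
and does not decrease the distance to any set `A` compatible with the coloring.
Colors `{1, 2}` are modeled as `Fin 2` (with `0 ↔ 1` and `1 ↔ 2`);
`c⁻¹(i)` is the set of elements of `B₀` colored `i`. -/
theorem two_colored_count_preserving_exchange
    {α : Type*} [DecidableEq α] (B₀ : Finset α) (c : α → Fin 2)
    (M S Shat : Finset α) (hM : M ⊆ B₀) (hS : S ⊆ B₀) (hShat : Shat ⊆ B₀)
    (hcount : ∀ i : Fin 2,
      (Shat ∩ ((B₀.filter fun x => c x = i) ∩ M)).card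
        = (S ∩ ((B₀.filter fun x => c x = i) ∩ M)).card ∧
      (Shat ∩ ((B₀.filter fun x => c x = i) \ M)).card
        = (S ∩ ((B₀.filter fun x => c x = i) \ M)).card) :
    (symmDiff Shat M).card = (symmDiff S M).card ∧
    ∀ A : Finset α,
      S \ A ⊆ (B₀.filter fun x => c x = 0) →
      A \ S ⊆ (B₀.filter fun x => c x = 1) →
      (symmDiff A S).card ≤ (symmDiff A Shat).card := by
  have hM_card : (Shat ∩ M).card = (S ∩ M).card := by
    rw [Finset.card_eq_card_inter_color_add c (Finset.inter_subset_left.trans hShat),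
      Finset.card_eq_card_inter_color_add c (Finset.inter_subset_left.trans hS)]
    simp only [Finset.inter_assoc, Finset.inter_comm M, (hcount _).1]
  have hsdiff_card : (Shat \ M).card = (S \ M).card := by
    rw [Finset.card_eq_card_inter_color_add c (Finset.sdiff_subset.trans hShat),
      Finset.card_eq_card_inter_color_add c (Finset.sdiff_subset.trans hS)]
    simp only [Finset.sdiff_inter_right_comm, Finset.inter_sdiff_assoc, (hcount _).2]
  have hcolor (i : Fin 2) : (Shat ∩ B₀.filter fun x => c x = i).card
      = (S ∩ B₀.filter fun x => c x = i).card := by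
    rw [← Finset.card_inter_add_card_sdiff (Shat ∩ _) M,
      ← Finset.card_inter_add_card_sdiff (S ∩ _) M]
    simp only [Finset.inter_assoc, Finset.inter_sdiff_assoc, (hcount i).1, (hcount i).2]
  refine ⟨?_, fun A hSA hAS => ?_⟩
  · have h₁ := Finset.card_inter_add_card_sdiff M Shat
    have h₂ := Finset.card_inter_add_card_sdiff M S
    rw [Finset.inter_comm] at h₁ h₂
    rw [Finset.card_symmDiff_eq_add, Finset.card_symmDiff_eq_add]
    omega
  · have h₀ := hcolor 0
    have h₁ := hcolor 1
    set C₀ := B₀.filter fun x => c x = 0 with hC₀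
    set C₁ := B₀.filter fun x => c x = 1 with hC₁
    have hdisj : Disjoint C₀ C₁ := by
      rw [Finset.disjoint_left]
      intro x hx hx'
      simp_all
    rw [Finset.disjoint_left] at hdisj
    have hA₀ : A ∩ C₀ ⊆ S ∩ C₀ := by grind
    have hS₁ : S ∩ C₁ ⊆ A ∩ C₁ := by grind
    have hSA_eq : S \ A = (S ∩ C₀) \ (A ∩ C₀) := by grind
    have hAS_eq : A \ S = (A ∩ C₁) \ (S ∩ C₁) := by grind
    have hle₀ : ((Shat ∩ C₀) \ (A ∩ C₀)).card ≤ (Shat \ A).card :=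
      Finset.card_le_card (by grind)
    have hle₁ : ((A ∩ C₁) \ (Shat ∩ C₁)).card ≤ (A \ Shat).card :=
      Finset.card_le_card (by grind)
    have hge₀ := Finset.le_card_sdiff (A ∩ C₀) (Shat ∩ C₀)
    have hge₁ := Finset.le_card_sdiff (Shat ∩ C₁) (A ∩ C₁)
    rw [Finset.card_symmDiff_eq_add, Finset.card_symmDiff_eq_add, hSA_eq, hAS_eq,
      Finset.card_sdiff_of_subset hA₀, Finset.card_sdiff_of_subset hS₁]
    omega
end

section
/- Let B₀ be a finite set, c : B₀ → {1,2,3,4} a coloring, and S, Ŝ ⊆ B₀ with |Ŝ ∩ c⁻¹(i)| = |S ∩ c⁻¹(i)| for all i ∈ {1,2,3,4}. Then for all sets A, B satisfying A \ (B ∪ S) ⊆ c⁻¹(1), B \ (A ∪ S) ⊆ c⁻¹(2), (A ∩ B) \ S ⊆ c⁻¹(3), and S \ (A ∩ B) ⊆ c⁻¹(4), it holds that |A Δ Ŝ| ≥ |A Δ S| and |B Δ Ŝ| ≥ |B Δ S|. -/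
/-- If `S \ A` lies in `K` and `A \ S` misses `K`, then no set `T` having as many elements as `S`
both in total and inside `K` is closer to `A` than `S` is. -/
theorem Finset.card_symmDiff_le_card_symmDiff_of_card_inter_eq {α : Type*} [DecidableEq α]
    {A S T K : Finset α} (hcard : T.card = S.card) (hK : (T ∩ K).card = (S ∩ K).card)
    (hSA : S \ A ⊆ K) (hAS : Disjoint (A \ S) K) :
    (symmDiff A S).card ≤ (symmDiff A T).card := by
  have card_symmDiff_add (U : Finset α) :
      (symmDiff A U).card + 2 * (A ∩ U).card = A.card + U.card := by
    have hdisj : Disjoint (A \ U) (U \ A) := disjoint_sdiff_sdiff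
    have hA := Finset.card_sdiff_add_card_inter A U
    have hU := Finset.card_sdiff_add_card_inter U A
    have hsymm : (symmDiff A U).card = (A \ U).card + (U \ A).card :=
      Finset.card_union_of_disjoint hdisj
    rw [Finset.inter_comm U A] at hU
    omega
  have hT : (A ∩ T).card ≤ (A ∩ K).card + (T \ K).card := by
    refine (Finset.card_le_card fun x hx => ?_).trans (Finset.card_union_le _ _)
    simp only [Finset.mem_union, Finset.mem_inter, Finset.mem_sdiff] at hx ⊢
    tauto
  have hS : (A ∩ K).card + (S \ K).card ≤ (A ∩ S).card := by
    rw [← Finset.card_union_of_disjoint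
      (Finset.disjoint_sdiff.mono_left Finset.inter_subset_right)]
    refine Finset.card_le_card fun x hx => ?_
    have hxSA := @hSA x
    have hxAS := @Finset.disjoint_left.mp hAS x
    simp only [Finset.mem_union, Finset.mem_inter, Finset.mem_sdiff] at hx hxSA hxAS ⊢
    tauto
  have hTK := Finset.card_sdiff_add_card_inter T K
  have hSK := Finset.card_sdiff_add_card_inter S K
  have hsT := card_symmDiff_add T
  have hsS := card_symmDiff_add S
  omega

/-- four-colored count-preserving exchange does not decrease the
distances to sets `A` and `B` compatible with the coloring.
Colors `{1, 2, 3, 4}` are modeled as `Fin 4` (with `0 ↔ 1`, ..., `3 ↔ 4`);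
`c⁻¹(i)` is the set of elements of `B₀` colored `i`. -/
theorem four_colored_count_preserving_exchange
    {α : Type*} [DecidableEq α] (B₀ : Finset α) (c : α → Fin 4)
    (S Shat : Finset α) (hS : S ⊆ B₀) (hShat : Shat ⊆ B₀)
    (hcount : ∀ i : Fin 4,
      (Shat ∩ (B₀.filter fun x => c x = i)).card
        = (S ∩ (B₀.filter fun x => c x = i)).card)
    (A B : Finset α)
    (h1 : A \ (B ∪ S) ⊆ (B₀.filter fun x => c x = 0))
    (h2 : B \ (A ∪ S) ⊆ (B₀.filter fun x => c x = 1))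
    (h3 : (A ∩ B) \ S ⊆ (B₀.filter fun x => c x = 2))
    (h4 : S \ (A ∩ B) ⊆ (B₀.filter fun x => c x = 3)) :
    (symmDiff A S).card ≤ (symmDiff A Shat).card ∧
    (symmDiff B S).card ≤ (symmDiff B Shat).card := by
  have card_eq_sum (U : Finset α) (hU : U ⊆ B₀) :
      U.card = ∑ i, (U ∩ (B₀.filter fun x => c x = i)).card := by
    rw [Finset.card_eq_sum_card_fiberwise (f := c) (t := Finset.univ) (by simp)]
    refine Finset.sum_congr rfl fun i _ => ?_
    rw [Finset.inter_filter, Finset.inter_eq_left.mpr hU]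
  have hcard : Shat.card = S.card := by
    rw [card_eq_sum Shat hShat, card_eq_sum S hS]
    exact Finset.sum_congr rfl fun i _ => hcount i
  have hdisj (x : α) (hx : x ∈ A ∪ B) (hxS : x ∉ S) : c x ≠ 3 := by
    intro hc
    have hA := @h1 x
    have hB := @h2 x
    have hAB := @h3 x
    simp only [Finset.mem_union, Finset.mem_inter, Finset.mem_sdiff, Finset.mem_filter, hc,
      Fin.reduceEq, and_false] at hx hA hB hAB
    tauto
  constructor
  · refine Finset.card_symmDiff_le_card_symmDiff_of_card_inter_eq hcard (hcount 3)
      ((Finset.sdiff_subset_sdiff subset_rfl Finset.inter_subset_left).trans h4)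
      (Finset.disjoint_left.mpr fun x hx hx3 => ?_)
    rw [Finset.mem_sdiff] at hx
    exact hdisj x (Finset.mem_union_left B hx.1) hx.2 (Finset.mem_filter.mp hx3).2
  · refine Finset.card_symmDiff_le_card_symmDiff_of_card_inter_eq hcard (hcount 3)
      ((Finset.sdiff_subset_sdiff subset_rfl Finset.inter_subset_right).trans h4)
      (Finset.disjoint_left.mpr fun x hx hx3 => ?_)
    rw [Finset.mem_sdiff] at hx
    exact hdisj x (Finset.mem_union_right A hx.1) hx.2 (Finset.mem_filter.mp hx3).2
end

section
/- Let A be a finite set with |A| = n, let b ≤ n, and let 𝒰 be a (2n, 2b)-universal family of subsets of {1, …, 2n}. Then there exists a family of colorings {c_U : A → {1,2,3,4} | U ∈ 𝒰} such that for all pairwise disjoint subsets B₁, B₂, B₃, B₄ ⊆ A with |B₁ ∪ B₂ ∪ B₃ ∪ B₄| ≤ b there exists U ∈ 𝒰 with c_U(x) = i for every x ∈ Bᵢ and every i ∈ {1,2,3,4}. -/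
/-- from a `(2n, 2b)`-universal family `𝒰` of subsets of `{1, …, 2n}`
(modeled as `Fin (2 * n)`) one obtains a family of colorings `{c_U : A → {1,2,3,4}}`
(colors modeled as `Fin 4`) such that every four pairwise disjoint subsets
`B₀, B₁, B₂, B₃ ⊆ A` of total size at most `b` are correctly colored by some `c_U`. -/
theorem universal_sets_give_colorings
    {α : Type*} [DecidableEq α] (A : Finset α) (n b : ℕ)
    (hn : A.card = n) (hb : b ≤ n)
    (𝒰 : Finset (Finset (Fin (2 * n))))
    (huniv : ∀ B' : Finset (Fin (2 * n)), B'.card = 2 * b →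
      ∀ T ⊆ B', ∃ U ∈ 𝒰, B' ∩ U = T) :
    ∃ col : Finset (Fin (2 * n)) → α → Fin 4,
      ∀ B : Fin 4 → Finset α,
        (∀ i, B i ⊆ A) →
        (∀ i j, i ≠ j → Disjoint (B i) (B j)) →
        (B 0 ∪ B 1 ∪ B 2 ∪ B 3).card ≤ b →
        ∃ U ∈ 𝒰, ∀ i, ∀ x ∈ B i, col U x = i := by
  classical
  have hcard : Fintype.card (A × Bool) = 2 * n := by
    simp [hn, Nat.mul_comm]
  let e : A × Bool ≃ Fin (2 * n) := Fintype.equivFinOfCardEq hcard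
  refine ⟨fun U x => if hx : x ∈ A then
      (if e (⟨x, hx⟩, false) ∈ U then (if e (⟨x, hx⟩, true) ∈ U then 3 else 1)
      else (if e (⟨x, hx⟩, true) ∈ U then 2 else 0)) else 0, ?_⟩
  intro B hBA hdisj hsize
  let S := B 0 ∪ B 1 ∪ B 2 ∪ B 3
  let W : Finset (Fin (2 * n)) :=
    (S.subtype (· ∈ A) ×ˢ (Finset.univ : Finset Bool)).map e.toEmbedding
  have hW : W.card ≤ 2 * b := by
    have hS : (S.subtype (· ∈ A)).card ≤ b := by
      rw [Finset.card_subtype]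
      exact (Finset.card_filter_le _ _).trans hsize
    simp only [W, Finset.card_map, Finset.card_product, Finset.card_univ, Fintype.card_bool]
    lia
  obtain ⟨B', hWB', hB'⟩ := Finset.exists_superset_card_eq hW (by simpa using hb)
  let T := B'.filter fun t =>
    ((e.symm t).1 : α) ∈ B 3 ∨ ((e.symm t).1 : α) ∈ if (e.symm t).2 then B 2 else B 1
  obtain ⟨U, hU, hUT⟩ := huniv B' hB' T (Finset.filter_subset _ _)
  refine ⟨U, hU, fun i x hx => ?_⟩
  have hxA : x ∈ A := hBA i hx
  have hxS : x ∈ S := by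
    simp only [S, Finset.mem_union]
    fin_cases i <;> simp_all
  have key (c : Bool) : e (⟨x, hxA⟩, c) ∈ U ↔ x ∈ B 3 ∨ x ∈ if c then B 2 else B 1 := by
    have hmem : e (⟨x, hxA⟩, c) ∈ B' := hWB' (by simp [W, hxS])
    have h := Finset.ext_iff.mp hUT (e (⟨x, hxA⟩, c))
    simpa [T, hmem] using h
  have hmem_iff (j : Fin 4) : x ∈ B j ↔ j = i := by
    refine ⟨fun hj => ?_, fun h => h ▸ hx⟩
    by_contra hne
    exact Finset.disjoint_left.mp (hdisj j i hne) hj hx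
  simp only [hxA, dite_true, key, if_true, Bool.false_eq_true, if_false, hmem_iff]
  clear key hmem_iff hx
  fin_cases i <;> rfl
end

section
/- Let ℓ ∈ ℕ, let B₀ be a finite set, and let F be a family of subsets of B₀. Let M* ∈ F be such that every M ∈ F satisfies |M Δ M*| ≤ 2ℓ. Let 𝒞 be a family of colorings c : B₀ → {1,2,3,4} such that for all pairwise disjoint B₁, B₂, B₃, B₄ ⊆ B₀ with |B₁ ∪ B₂ ∪ B₃ ∪ B₄| ≤ 8ℓ there is a c ∈ 𝒞 with c(x) = i for every x ∈ Bᵢ and every i ∈ {1,2,3,4}. Let F̂ ⊆ F be a subfamily such that M* ∈ F̂ and for every c ∈ 𝒞 and every S ∈ F there exists Ŝ ∈ F̂ with |Ŝ ∩ c⁻¹(i)| = |S ∩ c⁻¹(i)| for all i ∈ {1,2,3,4}. Then F̂ is an ℓ-diverse representative of F. -/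
/-- A triangle-inequality principle: if `A` lies between `P` and `S`, and `S`, `T` are equidistant
from `P`, then `T` is at least as far from `A` as `S` is. -/
theorem card_symmDiff_le_of_disjoint {α : Type*} [DecidableEq α] {A P S T : Finset α}
    (hdisj : Disjoint (symmDiff P A) (symmDiff A S)) (hcard : T.card = S.card)
    (hinter : (T ∩ P).card = (S ∩ P).card) :
    (symmDiff A S).card ≤ (symmDiff A T).card := by
  have key (U V : Finset α) : (symmDiff U V).card + 2 * (V ∩ U).card = U.card + V.card := by
    have h1 := Finset.card_sdiff_add_card_inter U V
    have h2 := Finset.card_sdiff_add_card_inter V U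
    have h3 : (symmDiff U V).card = (U \ V).card + (V \ U).card :=
      Finset.card_union_of_disjoint disjoint_sdiff_sdiff
    rw [Finset.inter_comm U V] at h1
    omega
  have hS : (symmDiff P S).card = (symmDiff P A).card + (symmDiff A S).card := by
    rw [← symmDiff_symmDiff_cancel_right A P, symmDiff_assoc, hdisj.symmDiff_eq_sup]
    simpa using Finset.card_union_of_disjoint hdisj
  have hT : (symmDiff P T).card ≤ (symmDiff P A).card + (symmDiff A T).card :=
    (Finset.card_le_card (symmDiff_triangle P A T)).trans (Finset.card_union_le _ _)
  have h1 := key P S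
  have h2 := key P T
  omega

/-- If `S, T ⊆ B₀` have the same number of elements of each color, and on `symmDiff A S` membership
in `A` is determined by the color lying in `I`, then `T` is at least as far from `A` as `S` is. -/
theorem card_symmDiff_le_of_card_color_eq {α ι : Type*} [DecidableEq α] [Fintype ι]
    [DecidableEq ι] {B₀ A S T : Finset α} (c : α → ι) (I : Finset ι) (hS : S ⊆ B₀) (hT : T ⊆ B₀)
    (hcount : ∀ i, (T ∩ B₀.filter fun x => c x = i).card
      = (S ∩ B₀.filter fun x => c x = i).card)
    (hI : ∀ x ∈ B₀, x ∈ symmDiff A S → (c x ∈ I ↔ x ∈ A)) :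
    (symmDiff A S).card ≤ (symmDiff A T).card := by
  have hsum {U : Finset α} (hU : U ⊆ B₀) (J : Finset ι) :
      (U.filter fun x => c x ∈ J).card
        = ∑ i ∈ J, (U ∩ B₀.filter fun x => c x = i).card := by
    rw [Finset.card_eq_sum_card_fiberwise (f := c) (t := J) (fun x hx => by simp_all)]
    refine Finset.sum_congr rfl fun i hi => congrArg Finset.card ?_
    ext x
    simp only [Finset.mem_filter, Finset.mem_inter]
    grind
  have hfilter (J : Finset ι) :
      (T.filter fun x => c x ∈ J).card = (S.filter fun x => c x ∈ J).card := by
    rw [hsum hT, hsum hS]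
    exact Finset.sum_congr rfl fun i _ => hcount i
  have hinter {U : Finset α} (hU : U ⊆ B₀) :
      U ∩ ((B₀.filter fun x => c x ∈ I) ∪ A \ B₀) = U.filter fun x => c x ∈ I := by
    ext x
    have := @hU x
    grind
  refine card_symmDiff_le_of_disjoint (P := (B₀.filter fun x => c x ∈ I) ∪ A \ B₀) ?_ ?_ ?_
  · rw [Finset.disjoint_left]
    intro x hxP hxS
    have := hI x
    simp only [Finset.mem_symmDiff, Finset.mem_union, Finset.mem_filter, Finset.mem_sdiff]
      at hxP hxS this
    tauto
  · simpa using hfilter Finset.univ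
  · rw [hinter hT, hinter hS]
    exact hfilter I


/-- one-solution case: if every solution is within distance `2ℓ`
of `M*`, and `Fhat` contains `M*` together with, for every coloring `c` of a
family `𝒞` covering all disjoint quadruples of total size at most `8ℓ`, a
count-preserving representative of every `S ∈ F`, then `Fhat` is an `ℓ`-diverse
representative of `F`. Colors `{1,2,3,4}` are modeled as `Fin 4`. -/
theorem one_solution_case_diverse_representative
    {α : Type*} [DecidableEq α] (ℓ : ℕ) (B₀ : Finset α)
    (F Fhat : Set (Finset α)) (hFB : ∀ S ∈ F, S ⊆ B₀) (hsub : Fhat ⊆ F)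
    (Mstar : Finset α) (hMstarF : Mstar ∈ F)
    (hclose : ∀ M ∈ F, (symmDiff M Mstar).card ≤ 2 * ℓ)
    (𝒞 : Set (α → Fin 4))
    (h𝒞 : ∀ B : Fin 4 → Finset α,
      (∀ i, B i ⊆ B₀) →
      (∀ i j, i ≠ j → Disjoint (B i) (B j)) →
      (B 0 ∪ B 1 ∪ B 2 ∪ B 3).card ≤ 8 * ℓ →
      ∃ c ∈ 𝒞, ∀ i, ∀ x ∈ B i, c x = i)
    (hMstar : Mstar ∈ Fhat)
    (hrep : ∀ c ∈ 𝒞, ∀ S ∈ F, ∃ Shat ∈ Fhat, ∀ i : Fin 4,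
      (Shat ∩ (B₀.filter fun x => c x = i)).card
        = (S ∩ (B₀.filter fun x => c x = i)).card) :
    IsDiverseRep ℓ F Fhat := by
  have hdist (U V W : Finset α) :
      (symmDiff U W).card ≤ (symmDiff U V).card + (symmDiff V W).card :=
    (Finset.card_le_card (symmDiff_triangle U V W)).trans (Finset.card_union_le _ _)
  have main (S : Finset α) (hS : S ∈ F) (A B : Finset α)
      (hA : (symmDiff A Mstar).card ≤ 3 * ℓ) (hB : (symmDiff B Mstar).card ≤ 3 * ℓ) :
      ∃ T ∈ Fhat, (symmDiff A S).card ≤ (symmDiff A T).card ∧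
        (symmDiff B S).card ≤ (symmDiff B T).card := by
    let D := B₀ ∩ (symmDiff A S ∪ symmDiff B S)
    let p : α → Fin 4 := fun x =>
      if x ∈ A then if x ∈ B then 0 else 1 else if x ∈ B then 2 else 3
    have hD : D.card ≤ 8 * ℓ := by
      have hDsub : D ⊆ symmDiff A Mstar ∪ symmDiff B Mstar ∪ symmDiff S Mstar := by
        intro x hx
        simp only [D, Finset.mem_inter, Finset.mem_union, Finset.mem_symmDiff] at hx ⊢
        tauto
      have h1 := Finset.card_le_card hDsub
      have h2 := Finset.card_union_le (symmDiff A Mstar ∪ symmDiff B Mstar) (symmDiff S Mstar)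
      have h3 := Finset.card_union_le (symmDiff A Mstar) (symmDiff B Mstar)
      have h4 := hclose S hS
      omega
    obtain ⟨c, hc, hcp⟩ := h𝒞 (fun i => D.filter fun x => p x = i)
      (fun i => (Finset.filter_subset _ _).trans Finset.inter_subset_left)
      (fun i j hij => Finset.disjoint_left.2 fun x hi hj =>
        hij ((Finset.mem_filter.1 hi).2.symm.trans (Finset.mem_filter.1 hj).2))
      ((Finset.card_le_card (by
        simp only [Finset.union_subset_iff, Finset.filter_subset, and_self])).trans hD)
    have hcD (x : α) (hx : x ∈ D) : c x = p x := hcp (p x) x (by simp [hx])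
    obtain ⟨T, hT, hcount⟩ := hrep c hc S hS
    refine ⟨T, hT, card_symmDiff_le_of_card_color_eq c {0, 1} (hFB S hS) (hFB T (hsub hT)) hcount ?_,
      card_symmDiff_le_of_card_color_eq c {0, 2} (hFB S hS) (hFB T (hsub hT)) hcount ?_⟩
    · intro x hx hxA
      rw [hcD x (Finset.mem_inter.2 ⟨hx, Finset.mem_union_left _ hxA⟩)]
      by_cases h1 : x ∈ A <;> by_cases h2 : x ∈ B <;> simp [p, h1, h2]
    · intro x hx hxB
      rw [hcD x (Finset.mem_inter.2 ⟨hx, Finset.mem_union_right _ hxB⟩)]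
      by_cases h1 : x ∈ A <;> by_cases h2 : x ∈ B <;> simp [p, h1, h2]
  have hfar (A T : Finset α) (hT : T ∈ Fhat) (hA : ¬ (symmDiff A Mstar).card ≤ 3 * ℓ) :
      ℓ ≤ (symmDiff A T).card := by
    have h1 := hdist A T Mstar
    have h2 := hclose T (hsub hT)
    omega
  have hMM : (symmDiff Mstar Mstar).card ≤ 3 * ℓ := by simp
  refine ⟨hsub, fun S hS A B hA hB => ?_⟩
  obtain ⟨T, hT, hTA, hTB⟩ := main S hS
    (if (symmDiff A Mstar).card ≤ 3 * ℓ then A else Mstar)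
    (if (symmDiff B Mstar).card ≤ 3 * ℓ then B else Mstar)
    (by split_ifs <;> assumption) (by split_ifs <;> assumption)
  refine ⟨T, hT, ?_, ?_⟩
  · by_cases h : (symmDiff A Mstar).card ≤ 3 * ℓ
    · rw [if_pos h] at hTA
      exact hA.trans hTA
    · exact hfar A T hT h
  · by_cases h : (symmDiff B Mstar).card ≤ 3 * ℓ
    · rw [if_pos h] at hTB
      exact hB.trans hTB
    · exact hfar B T hT h
end

section
/- Let ℓ ∈ ℕ, let B₀ be a finite set, and let F be a family of subsets of B₀. Let M₁, M₂ ∈ F with |M₁ Δ M₂| ≥ 2ℓ such that every M ∈ F satisfies min(|M Δ M₁|, |M Δ M₂|) ≤ 2ℓ. Let 𝒞 be a family of colorings c : B₀ → {1,2,3,4} such that for all pairwise disjoint B₁, B₂, B₃, B₄ ⊆ B₀ with |B₁ ∪ B₂ ∪ B₃ ∪ B₄| ≤ 10ℓ there is a c ∈ 𝒞 with c(x) = i for every x ∈ Bᵢ and every i ∈ {1,2,3,4}. For c ∈ 𝒞 let c′ : B₀ → {1,2} denote the coarsened coloring c′(x) := ⌈c(x)/2⌉. Let F̂ ⊆ F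 be a subfamily such that: (a) M₁, M₂ ∈ F̂; (b) for every c ∈ 𝒞 and every S ∈ F there exists Ŝ ∈ F̂ with |Ŝ ∩ c⁻¹(i)| = |S ∩ c⁻¹(i)| for all i ∈ {1,2,3,4}; and (c) for every c ∈ 𝒞, every j ∈ {1,2}, and every S ∈ F there exists Ŝ ∈ F̂ with |Ŝ ∩ c′⁻¹(a) ∩ M_j| = |S ∩ c′⁻¹(a) ∩ M_j| and |Ŝ ∩ c′⁻¹(a) \ M_j| = |S ∩ c′⁻¹(a) \ M_j| for both a ∈ {1,2}. Then F̂ is an ℓ-diverse representative of F. -/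
/-- The coarsening `c′` of a four-coloring `c` (colors modeled as `Fin 4`,
`0,1 ↦ 0` and `2,3 ↦ 1`, corresponding to `c′(x) = ⌈c(x)/2⌉` on `{1,2,3,4}`). -/
def coarsen {α : Type*} (c : α → Fin 4) : α → Fin 2 :=
  fun x => if (c x : ℕ) < 2 then 0 else 1

/-- If `D` contains `S \ A` and misses `A \ S`, then replacing `S` by a set with the same
number of elements inside and outside `D` does not decrease the distance to `A`. -/
lemma card_symmDiff_le_of_separates {α : Type*} [DecidableEq α] {A D S T : Finset α}
    (hin : (T ∩ D).card = (S ∩ D).card) (hout : (T \ D).card = (S \ D).card)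
    (hSA : S \ A ⊆ D) (hAS : Disjoint (A \ S) D) :
    (symmDiff A S).card ≤ (symmDiff A T).card := by
  have hcard (X : Finset α) : (symmDiff A X).card = (A \ X).card + (X \ A).card :=
    Finset.card_union_of_disjoint disjoint_sdiff_sdiff
  have hAS' : ∀ x ∈ A, x ∉ S → x ∉ D := fun x hA hS =>
    Finset.disjoint_left.1 hAS (Finset.mem_sdiff.2 ⟨hA, hS⟩)
  have h₁ : (S \ A).card ≤ (T \ A).card := by
    have hS : (S \ A).card + (A ∩ D).card = (S ∩ D).card := by
      rw [← Finset.card_union_of_disjoint (by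
        rw [Finset.disjoint_left]; grind)]
      congr 1
      ext x
      have := @hSA x
      grind
    have hT : (T ∩ D).card ≤ (T \ A).card + (A ∩ D).card :=
      (Finset.card_le_card (by grind)).trans (Finset.card_union_le _ _)
    omega
  have h₂ : (A \ S).card ≤ (A \ T).card := by
    have hS : (A \ S).card + (S \ D).card = (A \ D).card := by
      rw [← Finset.card_union_of_disjoint (by
        rw [Finset.disjoint_left]; grind)]
      congr 1
      ext x
      have := @hSA x
      grind
    have hT : (A \ D).card ≤ (A \ T).card + (T \ D).card :=
      (Finset.card_le_card (by grind)).trans (Finset.card_union_le _ _)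
    omega
  rw [hcard, hcard]
  omega

lemma card_symmDiff_triangle {α : Type*} [DecidableEq α] (A B C : Finset α) :
    (symmDiff A C).card ≤ (symmDiff A B).card + (symmDiff B C).card :=
  (Finset.card_le_card (symmDiff_triangle A B C)).trans (Finset.card_union_le _ _)

/-- A family of four-colorings covering all small disjoint quadruples has coarsenings
covering all small disjoint pairs. -/
lemma exists_coarsen_eq_of_covers {α : Type*} [DecidableEq α] {k : ℕ} {B₀ : Finset α}
    {𝒞 : Set (α → Fin 4)}
    (h𝒞 : ∀ B : Fin 4 → Finset α,
      (∀ i, B i ⊆ B₀) →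
      (∀ i j, i ≠ j → Disjoint (B i) (B j)) →
      (B 0 ∪ B 1 ∪ B 2 ∪ B 3).card ≤ k →
      ∃ c ∈ 𝒞, ∀ i, ∀ x ∈ B i, c x = i)
    {P Q : Finset α} (hP : P ⊆ B₀) (hQ : Q ⊆ B₀) (hPQ : Disjoint P Q)
    (hcard : (P ∪ Q).card ≤ k) :
    ∃ c ∈ 𝒞, (∀ x ∈ P, coarsen c x = 0) ∧ ∀ x ∈ Q, coarsen c x = 1 := by
  obtain ⟨c, hc, hcB⟩ := h𝒞 ![P, ∅, Q, ∅]
    (by intro i; fin_cases i <;> simp [hP, hQ])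
    (by intro i j; fin_cases i <;> fin_cases j <;> simp [hPQ, hPQ.symm])
    (by simpa using hcard)
  refine ⟨c, hc, fun x hx => ?_, fun x hx => ?_⟩
  · have := hcB 0 x (by simpa using hx)
    simp [coarsen, this]
  · have := hcB 2 x (by simpa using hx)
    simp [coarsen, this]

lemma coarsen_eq_zero_iff {α : Type*} (c : α → Fin 4) (x : α) :
    coarsen c x = 0 ↔ c x = 0 ∨ c x = 1 := by
  have h : ∀ y : Fin 4, (if (y : ℕ) < 2 then (0 : Fin 2) else 1) = 0 ↔ y = 0 ∨ y = 1 := by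
    decide
  exact h (c x)

lemma coarsen_eq_one_iff {α : Type*} (c : α → Fin 4) (x : α) :
    coarsen c x = 1 ↔ c x = 2 ∨ c x = 3 := by
  have h : ∀ y : Fin 4, (if (y : ℕ) < 2 then (0 : Fin 2) else 1) = 1 ↔ y = 2 ∨ y = 3 := by
    decide
  exact h (c x)

/-- A coarsened color class splits a set into its two original color classes. -/
lemma card_inter_coarsen_eq {α : Type*} [DecidableEq α] (B₀ T : Finset α) (c : α → Fin 4) :
    (T ∩ B₀.filter fun x => coarsen c x = 0).card
        = (T ∩ B₀.filter fun x => c x = 0).card + (T ∩ B₀.filter fun x => c x = 1).card ∧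
      (T ∩ B₀.filter fun x => coarsen c x = 1).card
        = (T ∩ B₀.filter fun x => c x = 2).card + (T ∩ B₀.filter fun x => c x = 3).card := by
  constructor <;>
  · rw [← Finset.card_union_of_disjoint (by
      rw [Finset.disjoint_left]; grind)]
    congr 1
    ext x
    have h₀ := coarsen_eq_zero_iff c x
    have h₁ := coarsen_eq_one_iff c x
    simp only [Finset.mem_inter, Finset.mem_union, Finset.mem_filter, h₀, h₁]
    tauto

/-- For a subset of `B₀`, the elements outside the first coarsened class are those in the
second. -/
lemma sdiff_coarsen_zero {α : Type*} [DecidableEq α] {B₀ T : Finset α} (hT : T ⊆ B₀)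
    (c : α → Fin 4) :
    T \ (B₀.filter fun x => coarsen c x = 0) = T ∩ B₀.filter fun x => coarsen c x = 1 := by
  ext x
  have := @hT x
  simp only [Finset.mem_inter, Finset.mem_sdiff, Finset.mem_filter]
  generalize coarsen c x = y
  fin_cases y <;> simp_all

/-- A coarsened color class splits a set into its parts inside and outside `M`. -/
lemma card_inter_coarsen_eq_add {α : Type*} [DecidableEq α] (B₀ M T : Finset α)
    (c : α → Fin 4) (a : Fin 2) :
    (T ∩ B₀.filter fun x => coarsen c x = a).card
      = (T ∩ ((B₀.filter fun x => coarsen c x = a) ∩ M)).card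
        + (T ∩ ((B₀.filter fun x => coarsen c x = a) \ M)).card := by
  rw [← Finset.inter_assoc, ← Finset.inter_sdiff_assoc, Finset.card_inter_add_card_sdiff]

lemma card_inter_sdiff_eq_add_coarsen {α : Type*} [DecidableEq α] {B₀ T : Finset α}
    (hT : T ⊆ B₀) (M : Finset α) (c : α → Fin 4) :
    (T ∩ (B₀ \ M)).card
        = (T ∩ ((B₀.filter fun x => coarsen c x = 0) \ M)).card
          + (T ∩ ((B₀.filter fun x => coarsen c x = 1) \ M)).card := by
  have hTM : T ∩ (B₀ \ M) ⊆ B₀ := Finset.inter_subset_left.trans hT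
  rw [← Finset.card_inter_add_card_sdiff (T ∩ (B₀ \ M)) (B₀.filter fun x => coarsen c x = 0),
    sdiff_coarsen_zero hTM]
  congr 2 <;>
  · ext x
    simp only [Finset.mem_inter, Finset.mem_sdiff, Finset.mem_filter]
    tauto

lemma card_sdiff_sdiff_eq_add_coarsen {α : Type*} [DecidableEq α] {B₀ T : Finset α}
    (hT : T ⊆ B₀) (M : Finset α) (c : α → Fin 4) :
    (T \ (B₀ \ M)).card
        = (T ∩ ((B₀.filter fun x => coarsen c x = 0) ∩ M)).card
          + (T ∩ ((B₀.filter fun x => coarsen c x = 1) ∩ M)).card := by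
  have hTM : T \ (B₀ \ M) ⊆ B₀ := Finset.sdiff_subset.trans hT
  rw [← Finset.card_inter_add_card_sdiff (T \ (B₀ \ M)) (B₀.filter fun x => coarsen c x = 0),
    sdiff_coarsen_zero hTM]
  congr 2 <;>
  · ext x
    simp only [Finset.mem_inter, Finset.mem_sdiff, Finset.mem_filter]
    tauto

/-- If `S` is near `M₁`, `A` is near `M₁` and `B` is near `M₂`, then the representatives of `S`
contain one that is far from both `A` and `B`. -/
lemma exists_representative_of_near {α : Type*} [DecidableEq α] {ℓ : ℕ} {B₀ : Finset α}
    {F Fhat : Set (Finset α)} (hFB : ∀ S ∈ F, S ⊆ B₀) (hsub : Fhat ⊆ F)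
    {M₁ M₂ : Finset α}
    {𝒞 : Set (α → Fin 4)}
    (h𝒞 : ∀ B : Fin 4 → Finset α,
      (∀ i, B i ⊆ B₀) →
      (∀ i j, i ≠ j → Disjoint (B i) (B j)) →
      (B 0 ∪ B 1 ∪ B 2 ∪ B 3).card ≤ 10 * ℓ →
      ∃ c ∈ 𝒞, ∀ i, ∀ x ∈ B i, c x = i)
    (hrep4 : ∀ c ∈ 𝒞, ∀ S ∈ F, ∃ Shat ∈ Fhat, ∀ i : Fin 4,
      (Shat ∩ (B₀.filter fun x => c x = i)).card
        = (S ∩ (B₀.filter fun x => c x = i)).card)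
    (hrep2 : ∀ c ∈ 𝒞, ∀ S ∈ F,
      ∃ Shat ∈ Fhat, ∀ a : Fin 2,
        (Shat ∩ ((B₀.filter fun x => coarsen c x = a) ∩ M₁)).card
          = (S ∩ ((B₀.filter fun x => coarsen c x = a) ∩ M₁)).card ∧
        (Shat ∩ ((B₀.filter fun x => coarsen c x = a) \ M₁)).card
          = (S ∩ ((B₀.filter fun x => coarsen c x = a) \ M₁)).card)
    {S A B : Finset α} (hS : S ∈ F) (hSM : (symmDiff S M₁).card ≤ 2 * ℓ)
    (hAS : ℓ ≤ (symmDiff A S).card) (hBS : ℓ ≤ (symmDiff B S).card)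
    (hAM : (symmDiff A M₁).card < ℓ) (hBM : (symmDiff B M₂).card < ℓ) :
    ∃ Shat ∈ Fhat, ℓ ≤ (symmDiff A Shat).card ∧ ℓ ≤ (symmDiff B Shat).card := by
  have hSB := hFB S hS
  have hASle : (symmDiff A S).card ≤ 3 * ℓ := by
    have := card_symmDiff_triangle A M₁ S
    rw [symmDiff_comm M₁ S] at this
    omega
  rcases le_total (symmDiff M₁ M₂).card (4 * ℓ) with hnear | hfar
  · have hBSle : (symmDiff B S).card ≤ 7 * ℓ := by
      have h₁ := card_symmDiff_triangle B M₂ S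
      have h₂ := card_symmDiff_triangle M₂ M₁ S
      rw [symmDiff_comm M₁ S, symmDiff_comm M₂ M₁] at h₂
      omega
    obtain ⟨c, hc, hc₀, hc₁⟩ := exists_coarsen_eq_of_covers h𝒞
      (P := S \ (A ∩ B)) (Q := ((A ∪ B) \ S) ∩ B₀)
      (by grind) (by grind) (by rw [Finset.disjoint_left]; grind)
      (calc
        _ ≤ (symmDiff A S ∪ symmDiff B S).card := Finset.card_le_card (by
          intro x
          simp only [Finset.mem_union, Finset.mem_symmDiff]
          grind)
        _ ≤ _ := (Finset.card_union_le _ _).trans (by omega))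
    obtain ⟨T, hT, hTS⟩ := hrep4 c hc S hS
    have hin : (T ∩ B₀.filter fun x => coarsen c x = 0).card
        = (S ∩ B₀.filter fun x => coarsen c x = 0).card := by
      rw [(card_inter_coarsen_eq B₀ T c).1, (card_inter_coarsen_eq B₀ S c).1, hTS, hTS]
    have hout : (T \ B₀.filter fun x => coarsen c x = 0).card
        = (S \ B₀.filter fun x => coarsen c x = 0).card := by
      rw [sdiff_coarsen_zero (hFB T (hsub hT)), sdiff_coarsen_zero hSB,
        (card_inter_coarsen_eq B₀ T c).2, (card_inter_coarsen_eq B₀ S c).2, hTS, hTS]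
    exact ⟨T, hT,
      hAS.trans (card_symmDiff_le_of_separates hin hout
        (by grind) (by rw [Finset.disjoint_left]; grind)),
      hBS.trans (card_symmDiff_le_of_separates hin hout
        (by grind) (by rw [Finset.disjoint_left]; grind))⟩
  · obtain ⟨c, hc, hc₀, hc₁⟩ := exists_coarsen_eq_of_covers h𝒞
      (P := S \ A) (Q := (A \ S) ∩ B₀)
      (by grind) (by grind) (by rw [Finset.disjoint_left]; grind)
      (calc
        _ ≤ (symmDiff A S).card := Finset.card_le_card (by
          intro x
          simp only [Finset.mem_union, Finset.mem_symmDiff]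
          grind)
        _ ≤ _ := by omega)
    obtain ⟨T, hT, hTS⟩ := hrep2 c hc S hS
    have hTB := hFB T (hsub hT)
    have hTM : (symmDiff M₁ T).card ≤ (symmDiff M₁ S).card :=
      card_symmDiff_le_of_separates (D := B₀ \ M₁)
        (by rw [card_inter_sdiff_eq_add_coarsen hSB, card_inter_sdiff_eq_add_coarsen hTB,
          (hTS 0).2, (hTS 1).2])
        (by rw [card_sdiff_sdiff_eq_add_coarsen hSB, card_sdiff_sdiff_eq_add_coarsen hTB,
          (hTS 0).1, (hTS 1).1])
        (by grind) (by rw [Finset.disjoint_left]; grind)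
    refine ⟨T, hT, hAS.trans (card_symmDiff_le_of_separates
        (D := B₀.filter fun x => coarsen c x = 0) ?_ ?_ ?_ ?_), ?_⟩
    · rw [card_inter_coarsen_eq_add B₀ M₁ T, card_inter_coarsen_eq_add B₀ M₁ S,
        (hTS 0).1, (hTS 0).2]
    · rw [sdiff_coarsen_zero hTB, sdiff_coarsen_zero hSB,
        card_inter_coarsen_eq_add B₀ M₁ T, card_inter_coarsen_eq_add B₀ M₁ S, (hTS 1).1, (hTS 1).2]
    · grind
    · rw [Finset.disjoint_left]
      grind
    · have h₁ := card_symmDiff_triangle M₁ T M₂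
      have h₂ := card_symmDiff_triangle T B M₂
      rw [symmDiff_comm T B] at h₂
      rw [symmDiff_comm M₁ S] at hTM
      omega

/-- two-solutions case: if `M₁, M₂ ∈ F` are at distance at least `2ℓ`
and every solution is within distance `2ℓ` of one of them, and `Fhat` contains
`M₁, M₂` together with count-preserving representatives for every coloring of a
family `𝒞` covering all disjoint quadruples of total size at most `10ℓ`
(both for the four-colorings and for their coarsenings refined by `M₁`, `M₂`),
then `Fhat` is an `ℓ`-diverse representative of `F`. -/
theorem two_solutions_case_diverse_representative
    {α : Type*} [DecidableEq α] (ℓ : ℕ) (B₀ : Finset α)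
    (F Fhat : Set (Finset α)) (hFB : ∀ S ∈ F, S ⊆ B₀) (hsub : Fhat ⊆ F)
    (M₁ M₂ : Finset α) (hM₁F : M₁ ∈ F) (hM₂F : M₂ ∈ F)
    (hfar : 2 * ℓ ≤ (symmDiff M₁ M₂).card)
    (hclose : ∀ M ∈ F,
      (symmDiff M M₁).card ≤ 2 * ℓ ∨ (symmDiff M M₂).card ≤ 2 * ℓ)
    (𝒞 : Set (α → Fin 4))
    (h𝒞 : ∀ B : Fin 4 → Finset α,
      (∀ i, B i ⊆ B₀) →
      (∀ i j, i ≠ j → Disjoint (B i) (B j)) →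
      (B 0 ∪ B 1 ∪ B 2 ∪ B 3).card ≤ 10 * ℓ →
      ∃ c ∈ 𝒞, ∀ i, ∀ x ∈ B i, c x = i)
    (hM₁ : M₁ ∈ Fhat) (hM₂ : M₂ ∈ Fhat)
    (hrep4 : ∀ c ∈ 𝒞, ∀ S ∈ F, ∃ Shat ∈ Fhat, ∀ i : Fin 4,
      (Shat ∩ (B₀.filter fun x => c x = i)).card
        = (S ∩ (B₀.filter fun x => c x = i)).card)
    (hrep2 : ∀ c ∈ 𝒞, ∀ Mj ∈ ({M₁, M₂} : Set (Finset α)), ∀ S ∈ F,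
      ∃ Shat ∈ Fhat, ∀ a : Fin 2,
        (Shat ∩ ((B₀.filter fun x => coarsen c x = a) ∩ Mj)).card
          = (S ∩ ((B₀.filter fun x => coarsen c x = a) ∩ Mj)).card ∧
        (Shat ∩ ((B₀.filter fun x => coarsen c x = a) \ Mj)).card
          = (S ∩ ((B₀.filter fun x => coarsen c x = a) \ Mj)).card) :
    IsDiverseRep ℓ F Fhat := by
  refine ⟨hsub, fun S hS A B hAS hBS => ?_⟩
  by_cases h₁ : ℓ ≤ (symmDiff A M₁).card ∧ ℓ ≤ (symmDiff B M₁).card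
  · exact ⟨M₁, hM₁, h₁⟩
  by_cases h₂ : ℓ ≤ (symmDiff A M₂).card ∧ ℓ ≤ (symmDiff B M₂).card
  · exact ⟨M₂, hM₂, h₂⟩
  have hrep₁ := fun c hc => hrep2 c hc M₁ (by simp)
  have hrep₂ := fun c hc => hrep2 c hc M₂ (by simp)
  have hA := card_symmDiff_triangle M₁ A M₂
  have hB := card_symmDiff_triangle M₁ B M₂
  rw [symmDiff_comm M₁ A] at hA
  rw [symmDiff_comm M₁ B] at hB
  have hcases : ((symmDiff A M₁).card < ℓ ∧ (symmDiff B M₂).card < ℓ) ∨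
      ((symmDiff B M₁).card < ℓ ∧ (symmDiff A M₂).card < ℓ) := by
    omega
  rcases hcases with ⟨hM₁', hM₂'⟩ | ⟨hM₁', hM₂'⟩ <;> rcases hclose S hS with hSM | hSM
  · exact exists_representative_of_near hFB hsub h𝒞 hrep4 hrep₁ hS hSM hAS hBS hM₁' hM₂'
  · simpa only [and_comm] using
      exists_representative_of_near hFB hsub h𝒞 hrep4 hrep₂ hS hSM hBS hAS hM₂' hM₁'
  · simpa only [and_comm] using
      exists_representative_of_near hFB hsub h𝒞 hrep4 hrep₁ hS hSM hBS hAS hM₁' hM₂'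
  · exact exists_representative_of_near hFB hsub h𝒞 hrep4 hrep₂ hS hSM hAS hBS hM₂' hM₁'
end

section
/- Let ℓ ∈ ℕ, let X be an infinite set, let τ ≥ 1, and for each i ∈ {1, …, τ} let Rᵢ be a family of finite subsets of X and Fᵢ ⊆ Rᵢ an ℓ-diverse representative of Rᵢ. Then there exists a sequence (S₁, …, S_τ) with Sᵢ ∈ Rᵢ for all i and |Sᵢ Δ Sᵢ₊₁| ≥ ℓ for all i ∈ {1, …, τ−1} if and only if there exists such a sequence with Sᵢ ∈ Fᵢ for all i. -/
theorem Finset.exists_le_card_symmDiff {α : Type*} [DecidableEq α] [Infinite α]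
    (n : ℕ) (S : Finset α) : ∃ T : Finset α, n ≤ (symmDiff T S).card := by
  obtain ⟨T, hST, hT⟩ := Infinite.exists_superset_card_eq S (S.card + n) (Nat.le_add_right _ _)
  refine ⟨T, ?_⟩
  rw [symmDiff_of_ge hST, Finset.card_sdiff_of_subset hST]
  lia

/-- If the constraint `P` holds only when `T` is far from `S`, then some set far from `S` equals
`T` whenever `P` holds. -/
theorem Finset.exists_le_card_symmDiff_eq_of {α : Type*} [DecidableEq α] [Infinite α]
    {n : ℕ} {S T : Finset α} {P : Prop} (h : P → n ≤ (symmDiff T S).card) :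
    ∃ A : Finset α, n ≤ (symmDiff A S).card ∧ (P → A = T) := by
  by_cases hP : P
  · exact ⟨T, h hP, fun _ => rfl⟩
  · obtain ⟨A, hA⟩ := Finset.exists_le_card_symmDiff n S
    exact ⟨A, hA, fun h => absurd h hP⟩

/-- replacing each family of solutions `R i` by an `ℓ`-diverse
representative `F i` preserves the existence of an `ℓ`-diverse sequence of
solutions `S 1, …, S τ` (families of finite subsets of an infinite set `X`,
modeled as an infinite type `α`). -/
theorem diverse_representatives_preserve_diverse_sequences
    {α : Type*} [DecidableEq α] [Infinite α] (ℓ τ : ℕ) (hτ : 1 ≤ τ)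
    (R F : ℕ → Set (Finset α))
    (hrep : ∀ i, 1 ≤ i → i ≤ τ → IsDiverseRep ℓ (R i) (F i)) :
    (∃ S : ℕ → Finset α,
      (∀ i, 1 ≤ i → i ≤ τ → S i ∈ R i) ∧
      (∀ i, 1 ≤ i → i ≤ τ - 1 → ℓ ≤ (symmDiff (S i) (S (i + 1))).card)) ↔
    (∃ S : ℕ → Finset α,
      (∀ i, 1 ≤ i → i ≤ τ → S i ∈ F i) ∧
      (∀ i, 1 ≤ i → i ≤ τ - 1 → ℓ ≤ (symmDiff (S i) (S (i + 1))).card)) := by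
  constructor
  · rintro ⟨S₀, hS₀, hd₀⟩
    have key : ∀ k ≤ τ, ∃ S : ℕ → Finset α,
        (∀ i, 1 ≤ i → i ≤ τ → S i ∈ R i) ∧ (∀ i, 1 ≤ i → i ≤ k → S i ∈ F i) ∧
        (∀ i, 1 ≤ i → i ≤ τ - 1 → ℓ ≤ (symmDiff (S i) (S (i + 1))).card) := by
      intro k
      induction k with
      | zero => exact fun _ => ⟨S₀, hS₀, fun i h1 h2 => by lia, hd₀⟩
      | succ k ih =>
        intro hk
        obtain ⟨S, hR, hF, hd⟩ := ih (by lia)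
        obtain ⟨A, hA, hA'⟩ := Finset.exists_le_card_symmDiff_eq_of (S := S (k + 1))
          (T := S k) (P := 1 ≤ k) (fun h => hd k h (by lia))
        obtain ⟨B, hB, hB'⟩ := Finset.exists_le_card_symmDiff_eq_of (S := S (k + 1))
          (T := S (k + 2)) (P := k + 1 ≤ τ - 1)
          (fun h => symmDiff_comm (S (k + 1)) _ ▸ hd (k + 1) (by lia) h)
        obtain ⟨hsub, hdiv⟩ := hrep (k + 1) (by lia) hk
        obtain ⟨T, hT, hAT, hBT⟩ := hdiv _ (hR (k + 1) (by lia) hk) A B hA hB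
        refine ⟨Function.update S (k + 1) T, fun i h1 h2 => ?_, fun i h1 h2 => ?_,
          fun i h1 h2 => ?_⟩
        · rcases eq_or_ne i (k + 1) with rfl | hi
          · simpa using hsub hT
          · simpa [hi] using hR i h1 h2
        · rcases eq_or_ne i (k + 1) with rfl | hi
          · simpa using hT
          · simpa [hi] using hF i h1 (by lia)
        · rcases eq_or_ne i (k + 1) with rfl | hi
          · rw [hB' h2, symmDiff_comm] at hBT
            simpa using hBT
          · rcases eq_or_ne i k with rfl | hi'
            · rw [hA' h1] at hAT
              simpa using hAT
            · simpa [hi, hi'] using hd i h1 h2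
    obtain ⟨S, -, hF, hd⟩ := key τ le_rfl
    exact ⟨S, hF, hd⟩
  · rintro ⟨S, hF, hd⟩
    exact ⟨S, fun i h1 h2 => (hrep i h1 h2).1 (hF i h1 h2), hd⟩
end

section
/- Let G = (V, E) be a finite simple graph with |V| = n and let k > 1 be a natural number. Let v ∉ V be a new vertex, let G₁ be the complete graph on the vertex set V ∪ {v}, and let G₂ be the graph on V ∪ {v} with edge set E ∪ {{u, v} : u ∈ V}. Then G has an independent set of size at least k if and only if there exist a vertex cover S₁ of G₁ and a vertex cover S₂ of G₂ with |S₁| ≤ n, |S₂| ≤ n, and |S₁ Δ S₂| ≥ k + 1. -/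
/-- reduction from Independent Set to Diverse Multistage Vertex Cover
with two stages. The vertex set `V` of `G` is modeled as a finite type `α` with
`n = |α|`; the new vertex `v` is `none` in `Option α`. `G₁` is the complete graph
on `V ∪ {v}` and `G₂` is `G` plus the vertex `v` joined to every vertex of `V`.
Then `G` has an independent set of size at least `k` iff there are vertex covers
`S₁` of `G₁` and `S₂` of `G₂` with `|S₁| ≤ n`, `|S₂| ≤ n` and `|S₁ Δ S₂| ≥ k + 1`. -/
theorem independent_set_iff_diverse_vertex_covers
    {α : Type*} [Fintype α] [DecidableEq α]
    (G : SimpleGraph α) (n k : ℕ) (hn : Fintype.card α = n) (hk : 1 < k)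
    (G₁ G₂ : SimpleGraph (Option α))
    (hG₁ : G₁ = ⊤)
    (hG₂ : ∀ x y : Option α, G₂.Adj x y ↔
      ((∃ u w : α, x = some u ∧ y = some w ∧ G.Adj u w) ∨
        (x = none ∧ ∃ u : α, y = some u) ∨
        (y = none ∧ ∃ u : α, x = some u))) :
    (∃ S : Finset α, k ≤ S.card ∧ ∀ u ∈ S, ∀ w ∈ S, ¬ G.Adj u w) ↔
    (∃ S₁ S₂ : Finset (Option α),
      (∀ x y : Option α, G₁.Adj x y → x ∈ S₁ ∨ y ∈ S₁) ∧
      (∀ x y : Option α, G₂.Adj x y → x ∈ S₂ ∨ y ∈ S₂) ∧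
      S₁.card ≤ n ∧ S₂.card ≤ n ∧ k + 1 ≤ (symmDiff S₁ S₂).card) := by
  subst hG₁
  constructor
  · rintro ⟨S, hkS, hS⟩
    have hcard : Sᶜ.card + S.card = n := by rw [Finset.card_compl_add_card, hn]
    have hdiff : insert none (S.map Function.Embedding.some) ⊆
        symmDiff (Finset.univ.map Function.Embedding.some)
          (insert none (Sᶜ.map Function.Embedding.some)) := by
      rintro (_ | u) <;> simp [Finset.mem_symmDiff]
    refine ⟨Finset.univ.map Function.Embedding.some,
      insert none (Sᶜ.map Function.Embedding.some), ?_, ?_, ?_, ?_, ?_⟩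
    · rintro (_ | x) (_ | y) <;> simp
    · rintro (_ | x) (_ | y) <;> simp [hG₂]
      intro hxy
      by_contra! h
      exact hS x h.1 y h.2 hxy
    · simp [hn]
    · rw [Finset.card_insert_of_notMem (by simp), Finset.card_map]
      omega
    · have h := Finset.card_le_card hdiff
      rw [Finset.card_insert_of_notMem (by simp), Finset.card_map] at h
      omega
  · rintro ⟨S₁, S₂, h₁, h₂, -, -, hdiff⟩
    have hS₁ : S₁ᶜ.card ≤ 1 := by
      rw [Finset.card_le_one]
      intro x hx y hy
      by_contra hxy
      rw [Finset.mem_compl] at hx hy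
      exact (h₁ x y hxy).elim hx hy
    have hsub : symmDiff S₁ S₂ ⊆ S₁ᶜ ∪ S₂ᶜ := by
      intro x
      simp only [Finset.mem_symmDiff, Finset.mem_union, Finset.mem_compl]
      tauto
    have hS₂ : k ≤ S₂ᶜ.card := by
      have := (Finset.card_le_card hsub).trans (Finset.card_union_le _ _)
      omega
    have hnone : none ∈ S₂ := by
      by_contra hnone
      have hle : S₂ᶜ ⊆ {none} := by
        rintro (_ | u) hu
        · simp
        · have := h₂ none (some u) ((hG₂ _ _).2 (by simp))
          simp_all
      have := Finset.card_le_card hle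
      rw [Finset.card_singleton] at this
      omega
    refine ⟨Finset.univ.filter (fun u => some u ∉ S₂), ?_, ?_⟩
    · have hle : S₂ᶜ ⊆
          (Finset.univ.filter (fun u => some u ∉ S₂)).map Function.Embedding.some := by
        rintro (_ | u) hu
        · simp_all
        · simpa using hu
      have := Finset.card_le_card hle
      rw [Finset.card_map] at this
      omega
    · intro u hu w hw huw
      have := h₂ (some u) (some w) ((hG₂ _ _).2 (Or.inl ⟨u, w, rfl, rfl, huw⟩))
      simp_all
end

section
/- Let A be a finite set of agents, C a finite set of candidates, u : A → C ∪ {∅} a voting profile, c : C → {1,2,3,4} a coloring, n₁, n₂, n₃, n₄ ∈ ℕ, and x ∈ ℕ. For a candidate v ∈ C let s(v) := |u⁻¹(v)| be its score. Then there exists a set C′ ⊆ C with |C′ ∩ c⁻¹(i)| = nᵢ for all i ∈ {1,2,3,4} and |{a ∈ A : u(a) ∈ C′}| ≥ x if and only if nᵢ ≤ |c⁻¹(i)| for all i ∈ {1,2,3,4} and Σ_{i=1}^{4} max{ Σ_{v ∈ D} s(v) : D ⊆ c⁻¹(i), |D| = nᵢ } ≥ x. -/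
/-- The number of agents voting for a member of `S` is the total score of `S`. -/
theorem card_filter_exists_mem_eq_sum {A C : Type*} [Fintype A] [DecidableEq A] [DecidableEq C]
    (u : A → Option C) (S : Finset C) :
    (Finset.univ.filter fun a => ∃ v ∈ S, u a = some v).card =
      ∑ v ∈ S, (Finset.univ.filter fun a => u a = some v).card := by
  rw [← Finset.card_biUnion]
  · congr 1
    ext a
    simp
  · intro v _ w _ hvw
    refine Finset.disjoint_left.2 fun a hv hw => hvw ?_
    rw [Finset.mem_filter] at hv hw
    exact Option.some.inj (hv.2.symm.trans hw.2)


/-- correctness of the greedy algorithm for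
4-Colored Exact Plurality Voting. Agents and candidates are modeled as finite
types `A` and `C`; the voting profile is `u : A → Option C` (`none` = abstain);
colors `{1,2,3,4}` are modeled as `Fin 4`. There is a committee `C' ⊆ C` with
exactly `n i` candidates of each color `i` receiving at least `x` votes in total
iff `n i ≤ |c⁻¹(i)|` for all `i` and the sum over the colors of the maximum total
score of `n i` candidates of color `i` is at least `x`. -/
theorem four_colored_exact_voting_greedy
    {A C : Type*} [Fintype A] [Fintype C] [DecidableEq A] [DecidableEq C]
    (u : A → Option C) (c : C → Fin 4) (n : Fin 4 → ℕ) (x : ℕ) :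
    (∃ C' : Finset C,
      (∀ i : Fin 4, (C'.filter fun v => c v = i).card = n i) ∧
      x ≤ (Finset.univ.filter fun a => ∃ v ∈ C', u a = some v).card) ↔
    ((∀ i : Fin 4, n i ≤ (Finset.univ.filter fun v => c v = i).card) ∧
      x ≤ ∑ i : Fin 4,
        ((Finset.univ.filter fun v => c v = i).powersetCard (n i)).sup
          (fun D => ∑ v ∈ D, (Finset.univ.filter fun a => u a = some v).card)) := by
  simp only [card_filter_exists_mem_eq_sum]
  constructor
  · rintro ⟨S, hS, hx⟩
    have hsub (i : Fin 4) :
        (S.filter fun v => c v = i) ⊆ Finset.univ.filter fun v => c v = i :=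
      Finset.filter_subset_filter _ (Finset.subset_univ S)
    refine ⟨fun i => hS i ▸ Finset.card_le_card (hsub i), hx.trans ?_⟩
    rw [← Finset.sum_fiberwise S c]
    exact Finset.sum_le_sum fun i _ =>
      Finset.le_sup (f := fun D => ∑ v ∈ D, (Finset.univ.filter fun a => u a = some v).card)
        (Finset.mem_powersetCard.2 ⟨hsub i, hS i⟩)
  · rintro ⟨hn, hx⟩
    choose D hD hsup using fun i => Finset.exists_mem_eq_sup _
      (Finset.powersetCard_nonempty.2 (hn i))
      (fun D => ∑ v ∈ D, (Finset.univ.filter fun a => u a = some v).card)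
    have hfiber (i : Fin 4) :
        ((Finset.univ.filter fun v => v ∈ D (c v)).filter fun v => c v = i) = D i := by
      ext v
      have hc : v ∈ D i → c v = i := fun hv =>
        (Finset.mem_filter.1 ((Finset.mem_powersetCard.1 (hD i)).1 hv)).2
      simp only [Finset.mem_filter, Finset.mem_univ, true_and]
      constructor
      · rintro ⟨hv, rfl⟩
        exact hv
      · intro hv
        exact ⟨(hc hv).symm ▸ hv, hc hv⟩
    refine ⟨Finset.univ.filter fun v => v ∈ D (c v), fun i => ?_, hx.trans_eq ?_⟩
    · rw [hfiber, (Finset.mem_powersetCard.1 (hD i)).2]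
    · rw [← Finset.sum_fiberwise _ c]
      exact Finset.sum_congr rfl fun i _ => by rw [hsup, hfiber]
end

section
/- Let G be a finite simple graph and let s ≠ t be two vertices of G such that the graph G′ obtained from G by adding the edge {s, t} is 2-connected. Then for every cycle C in G there exists an s-t path in G that contains at least one edge of C. -/
namespace SimpleGraph

variable {V : Type*} {G H : SimpleGraph V}

/-- `G` contains vertex-disjoint walks from `s` to `a` and from `t` to `b`. -/
def DisjointlyLinked (G : SimpleGraph V) (a b s t : V) : Prop :=
  ∃ (p : G.Walk s a) (q : G.Walk t b), p.support.Disjoint q.support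

/-- Any two vertices other than `v` are joined by a walk avoiding `v`, for every `v`. -/
def ConnectedAvoiding (G : SimpleGraph V) : Prop :=
  ∀ v x y : V, x ≠ v → y ≠ v → ∃ p : G.Walk x y, v ∉ p.support

theorem connectedAvoiding_of_induce_connected
    (h : ∀ v : V, (G.induce {u : V | u ≠ v}).Connected) : G.ConnectedAvoiding := by
  intro v x y hx hy
  obtain ⟨p⟩ := (h v).preconnected ⟨x, hx⟩ ⟨y, hy⟩
  refine ⟨p.map (Embedding.induce _).toHom, fun hv => ?_⟩
  obtain ⟨w, -, hw⟩ := List.mem_map.1 ((Walk.support_map _ p)▸ hv)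
  exact w.2 hw

/-- A walk ending in `R` has an initial segment that meets `R` exactly in its endpoint. -/
theorem Walk.exists_initial_segment_to_set (R : Set V) {x y : V} (p : G.Walk x y) (hy : y ∈ R) :
    ∃ v ∈ R, ∃ q : G.Walk x v, q.support ⊆ p.support ∧ ∀ z ∈ q.support, z ∈ R → z = v := by
  induction p with
  | nil => exact ⟨_, hy, .nil, by simp, by simp⟩
  | @cons x w y h p ih =>
    by_cases hx : x ∈ R
    · exact ⟨x, hx, .nil, by simp, by simp⟩
    · obtain ⟨v, hv, q, hqp, hq⟩ := ih hy
      refine ⟨v, hv, .cons h q, ?_, ?_⟩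
      · rw [Walk.support_cons, Walk.support_cons]
        exact List.cons_subset_cons x hqp
      · intro z hz hzR
        rw [Walk.support_cons, List.mem_cons] at hz
        rcases hz with rfl | hz
        · exact absurd hzR hx
        · exact hq z hz hzR

theorem Walk.IsPath.notMem_support_dropUntil [DecidableEq V] {x y v : V} {p : G.Walk x y}
    (hp : p.IsPath) (hv : v ∈ p.support) (hvx : v ≠ x) : x ∉ (p.dropUntil v hv).support := by
  cases p with
  | nil => exact absurd (by simpa using hv) hvx
  | cons h p =>
    rw [Walk.cons_isPath_iff] at hp
    have hv' : v ∈ p.support := by simpa [hvx] using hv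
    intro hx
    have : (Walk.cons h p).dropUntil v hv = p.dropUntil v hv' := by
      simp [Walk.dropUntil, Ne.symm hvx]
    rw [this] at hx
    exact hp.2 (p.support_dropUntil_subset_support hv' hx)

theorem DisjointlyLinked.step {a b s t u : V} (hG : G.ConnectedAvoiding)
    (h : G.DisjointlyLinked a b s t) (htu : G.Adj t u) (hus : u ≠ s) :
    G.DisjointlyLinked a b s u ∨ G.DisjointlyLinked b a s u := by
  classical
  obtain ⟨p, q, hpq⟩ := h
  by_cases hup : u ∈ p.support
  · let r := (p.dropUntil u hup).bypass
    have hr : r.IsPath := Walk.bypass_isPath _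
    have hrp : r.support ⊆ p.support :=
      List.Subset.trans (Walk.support_bypass_subset_support _) (p.support_dropUntil_subset_support hup)
    have hrq : r.support.Disjoint q.support := List.disjoint_of_subset_left hrp hpq
    have huq : u ∉ q.support := hpq hup
    obtain ⟨w, hw⟩ := hG u s t hus.symm htu.ne
    obtain ⟨v, hv, w', hw'w, hw'⟩ := w.exists_initial_segment_to_set
      {z | z ∈ r.support ∨ z ∈ q.support} (Or.inr q.start_mem_support)
    have huw' : u ∉ w'.support := fun h => hw (hw'w h)
    have hvu : v ≠ u := fun h => huw' (h ▸ w'.end_mem_support)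
    rcases hv with hv | hv
    · refine .inl ⟨w'.append (r.dropUntil v hv), .cons htu.symm q, fun z hz hzq => ?_⟩
      rw [Walk.support_cons, List.mem_cons] at hzq
      rw [Walk.mem_support_append_iff] at hz
      rcases hzq with rfl | hzq
      · exact hz.elim huw' (hr.notMem_support_dropUntil hv hvu)
      · rcases hz with hz | hz
        · exact hrq hv (hw' z hz (.inr hzq) ▸ hzq)
        · exact hrq (r.support_dropUntil_subset_support hv hz) hzq
    · refine .inr ⟨w'.append (q.dropUntil v hv), r, fun z hz hzr => ?_⟩
      rw [Walk.mem_support_append_iff] at hz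
      rcases hz with hz | hz
      · exact hrq (hw' z hz (.inl hzr) ▸ hzr) hv
      · exact hrq hzr (q.support_dropUntil_subset_support hv hz)
  · refine .inl ⟨p, .cons htu.symm q, fun z hz hzq => ?_⟩
    rw [Walk.support_cons, List.mem_cons] at hzq
    rcases hzq with rfl | hzq
    · exact hup hz
    · exact hpq hz hzq

theorem ConnectedAvoiding.disjointlyLinked (hG : G.ConnectedAvoiding) {a b s t : V}
    (hab : a ≠ b) (hst : s ≠ t) :
    G.DisjointlyLinked a b s t ∨ G.DisjointlyLinked b a s t := by
  have propagate : ∀ {x y : V} (p : G.Walk x y), s ∉ p.support →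
      (G.DisjointlyLinked a b s x ∨ G.DisjointlyLinked b a s x) →
      (G.DisjointlyLinked a b s y ∨ G.DisjointlyLinked b a s y) := by
    intro x y p
    induction p with
    | nil => exact fun _ h => h
    | @cons x w y hxw p ih =>
      intro hs h
      rw [Walk.support_cons, List.mem_cons, not_or] at hs
      have hws : w ≠ s := fun h => hs.2 (h ▸ p.start_mem_support)
      refine ih hs.2 ?_
      rcases h with h | h
      · exact h.step hG hxw hws
      · exact (h.step hG hxw hws).symm
  by_cases hsb : s = b
  · subst hsb
    obtain ⟨p, hp⟩ := hG s a t hab hst.symm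
    exact propagate p hp (.inr ⟨.nil, .nil, by simpa using hab⟩)
  · obtain ⟨p, hp⟩ := hG s b t (Ne.symm hsb) hst.symm
    obtain ⟨q, hq⟩ := hG b s a hsb hab
    exact propagate p hp (.inl ⟨q, .nil, by simpa using hq⟩)

/-- Walks in `H` that are disjoint and start at `s` and `t` do not use the edge `s(s, t)`, so with
an edge of `G` between their endpoints they give a path in any `G` differing from `H` only there. -/
theorem DisjointlyLinked.exists_isPath {a b s t : V} (h : H.DisjointlyLinked a b s t)
    (hHG : ∀ x y : V, H.Adj x y → G.Adj x y ∨ (x = s ∧ y = t) ∨ (x = t ∧ y = s))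
    (hab : G.Adj a b) : ∃ p : G.Walk s t, p.IsPath ∧ s(a, b) ∈ p.edges := by
  classical
  obtain ⟨p, q, hpq⟩ := h
  have transferable : ∀ {x y : V} (r : H.Walk x y), (s ∉ r.support ∨ t ∉ r.support) →
      ∀ e ∈ r.edges, e ∈ G.edgeSet := by
    intro x y r hr e he
    induction e using Sym2.ind with
    | _ c d =>
      have hc := r.fst_mem_support_of_mem_edges he
      have hd := r.snd_mem_support_of_mem_edges he
      rcases hHG c d (r.adj_of_mem_edges he) with h | ⟨rfl, rfl⟩ | ⟨rfl, rfl⟩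
      · exact h
      · tauto
      · tauto
  have hp := transferable p (.inr fun h => hpq h q.start_mem_support)
  have hq := transferable q (.inl fun h => hpq p.start_mem_support h)
  let p' := (p.transfer G hp).bypass
  let q' := (q.transfer G hq).bypass
  have hp' : p'.support ⊆ p.support := by
    simpa using (p.transfer G hp).support_bypass_subset_support
  have hq' : q'.support ⊆ q.support := by
    simpa using (q.transfer G hq).support_bypass_subset_support
  refine ⟨p'.append (.cons hab q'.reverse), ?_, by simp⟩
  rw [Walk.isPath_def, Walk.support_append, Walk.support_cons, List.tail_cons,
    Walk.support_reverse, List.nodup_append']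
  refine ⟨(Walk.bypass_isPath _).support_nodup,
    List.nodup_reverse.2 (Walk.bypass_isPath _).support_nodup, fun z hz hz' => ?_⟩
  exact hpq (hp' hz) (hq' (List.mem_reverse.1 hz'))

end SimpleGraph


/-- if adding the edge `{s, t}` to a finite simple graph `G` yields
a 2-connected graph `G'` (at least three vertices, connected, and still connected
after deleting any single vertex), then for every cycle `C` in `G` there is an
`s`-`t` path in `G` containing at least one edge of `C`. -/
theorem st_path_through_cycle_edge
    {V : Type*} [Fintype V] [DecidableEq V]
    (G G' : SimpleGraph V) (s t : V) (hst : s ≠ t)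
    (hG' : ∀ x y : V, G'.Adj x y ↔
      (G.Adj x y ∨ (x = s ∧ y = t) ∨ (x = t ∧ y = s)))
    (hcard : 3 ≤ Fintype.card V)
    (hconn : G'.Connected)
    (h2conn : ∀ v : V, (G'.induce {u : V | u ≠ v}).Connected)
    (v₀ : V) (C : G.Walk v₀ v₀) (hC : C.IsCycle) :
    ∃ p : G.Walk s t, p.IsPath ∧ ∃ e ∈ p.edges, e ∈ C.edges := by
  obtain ⟨e, he⟩ := List.exists_mem_of_ne_nil C.edges (by simpa using hC.not_nil)
  induction e using Sym2.ind with
  | _ a b =>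
    have hab : G.Adj a b := C.adj_of_mem_edges he
    rcases (SimpleGraph.connectedAvoiding_of_induce_connected h2conn).disjointlyLinked hab.ne hst
      with h | h
    · obtain ⟨p, hp, hpe⟩ := h.exists_isPath (fun x y => (hG' x y).1) hab
      exact ⟨p, hp, _, hpe, he⟩
    · obtain ⟨p, hp, hpe⟩ := h.exists_isPath (fun x y => (hG' x y).1) hab.symm
      exact ⟨p, hp, _, hpe, Sym2.eq_swap ▸ he⟩
end

section
/- Let ℓ ≥ 1, let G be a finite simple graph, and let s ≠ t be two vertices of G such that the graph G′ obtained from G by adding the edge {s, t} is 2-connected. Suppose G contains two vertex-disjoint cycles C and C′, each with at least 4ℓ vertices. Then there exist three s-t paths P₁, P₂, P₃ in G such that |V(Pᵢ) Δ V(Pⱼ)| ≥ 2ℓ for all distinct i, j ∈ {1,2,3}, where V(P) denotes the vertex set of a path P. -/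
namespace SimpleGraph

variable {V : Type*} {G : SimpleGraph V}

/-- A path containing a vertex of `S` splits at its first vertex in `S`. -/
theorem Walk.IsPath.exists_split_at_first {u w : V} {p : G.Walk u w} (hp : p.IsPath) (S : Set V)
    (h : ∃ z ∈ p.support, z ∈ S) :
    ∃ (f : V) (p₁ : G.Walk u f) (p₂ : G.Walk f w), p₁.IsPath ∧ p₂.IsPath ∧ f ∈ S ∧
      (∀ z, z ∈ p.support ↔ z ∈ p₁.support ∨ z ∈ p₂.support) ∧
      (∀ z ∈ p₁.support, z ∈ p₂.support → z = f) ∧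
      (∀ z ∈ p₁.support, z ∈ S → z = f) := by
  induction p with
  | nil =>
    obtain ⟨z, hz, hzS⟩ := h
    simp only [Walk.support_nil, List.mem_singleton] at hz
    subst hz
    exact ⟨z, .nil, .nil, by simp, by simp, hzS, by simp, by simp, by simp⟩
  | @cons u v w e p ih =>
    by_cases hu : u ∈ S
    · exact ⟨u, .nil, .cons e p, by simp, hp, hu, by simp, by simp, by simp⟩
    · rw [Walk.cons_isPath_iff] at hp
      obtain ⟨z, hz, hzS⟩ := h
      obtain ⟨f, p₁, p₂, h₁, h₂, hf, hsup, hmeet, hfirst⟩ := ih hp.1 ⟨z, by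
        simp only [Walk.support_cons, List.mem_cons] at hz
        rcases hz with rfl | hz
        · exact absurd hzS hu
        · exact hz, hzS⟩
      have hu' := hp.2
      rw [hsup] at hu'
      push Not at hu'
      refine ⟨f, .cons e p₁, p₂, ?_, h₂, hf, ?_, ?_, ?_⟩
      · rw [Walk.cons_isPath_iff]
        exact ⟨h₁, hu'.1⟩
      · intro z
        simp only [Walk.support_cons, List.mem_cons, hsup, or_assoc]
      · intro z hz hz2
        simp only [Walk.support_cons, List.mem_cons] at hz
        rcases hz with rfl | hz
        · exact absurd hz2 hu'.2
        · exact hmeet z hz hz2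
      · intro z hz hz2
        simp only [Walk.support_cons, List.mem_cons] at hz
        rcases hz with rfl | hz
        · exact absurd hz2 hu
        · exact hfirst z hz hz2

theorem Walk.IsPath.append_of_meet {u v w : V} {p : G.Walk u v} {q : G.Walk v w}
    (hp : p.IsPath) (hq : q.IsPath) (h : ∀ z ∈ p.support, z ∈ q.support → z = v) :
    (p.append q).IsPath := by
  induction p with
  | nil => simpa using hq
  | cons e p ih =>
    rw [Walk.cons_isPath_iff] at hp
    rw [Walk.cons_append, Walk.cons_isPath_iff]
    refine ⟨ih hp.1 hq fun z hz => h z (by simp [hz]), ?_⟩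
    rw [Walk.mem_support_append_iff]
    rintro (hu | hu)
    · exact hp.2 hu
    · have := h _ (by simp) hu
      subst this
      exact hp.2 p.end_mem_support

/-- There are disjoint paths from `s` and from `t` to `S`, meeting `S` only in their ends. -/
def HasDisjointPathsTo (G : SimpleGraph V) (s t : V) (S : Set V) : Prop :=
  ∃ (a b : V) (p : G.Walk s a) (q : G.Walk t b), p.IsPath ∧ q.IsPath ∧ a ∈ S ∧ b ∈ S ∧
    (∀ z ∈ p.support, z ∉ q.support) ∧
    (∀ z ∈ p.support, z ∈ S → z = a) ∧ (∀ z ∈ q.support, z ∈ S → z = b)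

theorem HasDisjointPathsTo.symm {s t : V} {S : Set V} (h : G.HasDisjointPathsTo s t S) :
    G.HasDisjointPathsTo t s S := by
  obtain ⟨a, b, p, q, hp, hq, ha, hb, hd, hpS, hqS⟩ := h
  exact ⟨b, a, q, p, hq, hp, hb, ha, fun z hz hz' => hd z hz' hz, hqS, hpS⟩

theorem hasDisjointPathsTo_of_walks {s t a b : V} {S : Set V} (p : G.Walk s a) (q : G.Walk t b)
    (ha : a ∈ S) (hb : b ∈ S) (hd : ∀ z ∈ p.support, z ∉ q.support)
    (hpS : ∀ z ∈ p.support, z ∈ S → z = a) (hqS : ∀ z ∈ q.support, z ∈ S → z = b) :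
    G.HasDisjointPathsTo s t S := by
  classical
  have h₁ := p.support_bypass_subset_support
  have h₂ := q.support_bypass_subset_support
  exact ⟨a, b, p.bypass, q.bypass, p.bypass_isPath, q.bypass_isPath, ha, hb,
    fun z hz hz' => hd z (h₁ hz) (h₂ hz'), fun z hz => hpS z (h₁ hz), fun z hz => hqS z (h₂ hz)⟩

/-- Disjoint paths to `insert v S`, one of which ends in `v`, can be rerouted to end in `S`. -/
theorem hasDisjointPathsTo_of_insert
    (hav : ∀ v x y : V, x ≠ v → y ≠ v → ∃ r : G.Walk x y, v ∉ r.support)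
    {s t v b c w : V} {S : Set V} (p : G.Walk s v) (q : G.Walk t b) (hq : q.IsPath)
    (hb : b ∈ S) (hd : ∀ z ∈ p.support, z ∉ q.support)
    (hpS : ∀ z ∈ p.support, z ∉ S) (hqS : ∀ z ∈ q.support, z ∈ S → z = b)
    (hc : c ∈ S) (hcb : c ≠ b) (hw : w ∈ S) (hvw : G.Adj v w) :
    G.HasDisjointPathsTo s t S := by
  classical
  have hpe : ∀ (x : V) (e : G.Adj v x) (z : V),
      z ∈ (p.append (.cons e .nil)).support ↔ z ∈ p.support ∨ z = x := by
    intro x e z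
    have := p.end_mem_support
    simp only [Walk.mem_support_append_iff, Walk.support_cons, Walk.support_nil, List.mem_cons,
      List.not_mem_nil, or_false]
    constructor
    · rintro (h | rfl | h) <;> simp_all
    · rintro (h | h) <;> simp_all
  by_cases hwb : w = b
  · subst hwb
    have hvw' : v ≠ w := hvw.ne
    obtain ⟨r, hr⟩ := hav w c v hcb hvw'
    have hrs := r.support_bypass_subset_support
    obtain ⟨z, r₁, r₃, hr₁, -, hzU, hsup, -, hfirst⟩ :=
      r.bypass_isPath.exists_split_at_first {z | z ∈ p.support ∨ z ∈ q.support}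
        ⟨v, Walk.end_mem_support _, Or.inl p.end_mem_support⟩
    obtain ⟨d, r₂, r₄, -, -, hdS, hsup₂, -, hfirst₂⟩ :=
      hr₁.reverse.exists_split_at_first S ⟨c, Walk.end_mem_support _, hc⟩
    have hr₂ : ∀ y ∈ r₂.support, y ∈ r₁.support := fun y hy => by
      simpa using (hsup₂ y).2 (Or.inl hy)
    have hr₂w : w ∉ r₂.support := fun h => hr (hrs ((hsup w).2 (Or.inl (hr₂ w h))))
    have hr₂U : ∀ y ∈ r₂.support, y ∈ p.support ∨ y ∈ q.support → y = z :=
      fun y hy => hfirst y (hr₂ y hy)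
    rcases hzU with hz | hz
    · refine hasDisjointPathsTo_of_walks ((p.takeUntil z hz).append r₂) q hdS hb ?_ ?_ hqS
      · intro y hy hyq
        rw [Walk.mem_support_append_iff] at hy
        rcases hy with hy | hy
        · exact hd y (p.support_takeUntil_subset_support hz hy) hyq
        · have := hr₂U y hy (Or.inr hyq)
          subst this
          exact hd y hz hyq
      · intro y hy hyS
        rw [Walk.mem_support_append_iff] at hy
        rcases hy with hy | hy
        · exact absurd hyS (hpS y (p.support_takeUntil_subset_support hz hy))
        · exact hfirst₂ y hy hyS
    · have hzw : z ≠ w := by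
        rintro rfl
        exact hr₂w r₂.start_mem_support
      have hwt : w ∉ (q.takeUntil z hz).support := Walk.endpoint_notMem_support_takeUntil hq hz hzw.symm
      refine hasDisjointPathsTo_of_walks (p.append (.cons hvw .nil))
        ((q.takeUntil z hz).append r₂) hb hdS ?_ ?_ ?_
      · intro y hy hyq
        rw [hpe] at hy
        rw [Walk.mem_support_append_iff] at hyq
        rcases hy with hy | rfl
        · rcases hyq with hyq | hyq
          · exact hd y hy (q.support_takeUntil_subset_support hz hyq)
          · have := hr₂U y hyq (Or.inl hy)
            subst this
            exact hd y hy hz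
        · exact hyq.elim hwt hr₂w
      · intro y hy hyS
        rw [hpe] at hy
        exact hy.resolve_left fun h => hpS y h hyS
      · intro y hy hyS
        rw [Walk.mem_support_append_iff] at hy
        rcases hy with hy | hy
        · have := hqS y (q.support_takeUntil_subset_support hz hy) hyS
          subst this
          exact absurd hy hwt
        · exact hfirst₂ y hy hyS
  · refine hasDisjointPathsTo_of_walks (p.append (.cons hvw .nil)) q hw hb ?_ ?_ hqS
    · intro y hy hyq
      rw [hpe] at hy
      rcases hy with hy | rfl
      · exact hd y hy hyq
      · exact hwb (hqS y hyq hw)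
    · intro y hy hyS
      rw [hpe] at hy
      exact hy.resolve_left fun h => hpS y h hyS

/-- The Menger theorem for two paths in a 2-connected graph. -/
theorem hasDisjointPathsTo_of_biconnected [Finite V] (hconn : G.Preconnected)
    (hav : ∀ v x y : V, x ≠ v → y ≠ v → ∃ r : G.Walk x y, v ∉ r.support)
    {s t : V} (hst : s ≠ t) (S : Set V) (hS : S.Nontrivial) : G.HasDisjointPathsTo s t S := by
  induction hn : Sᶜ.ncard using Nat.strong_induction_on generalizing S with
  | _ n ih =>
    by_cases hU : S = Set.univ
    · subst hU
      exact ⟨s, t, .nil, .nil, by simp, by simp, by simp, by simp, by simpa using hst, by simp,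
        by simp⟩
    · obtain ⟨x, hx⟩ := (Set.ne_univ_iff_exists_notMem S).1 hU
      obtain ⟨y, hy⟩ := hS.nonempty
      obtain ⟨r⟩ := hconn y x
      obtain ⟨e, -, hw, hv⟩ := r.exists_boundary_dart S hy hx
      obtain ⟨a, b, p, q, hp, hq, ha, hb, hd, hpS, hqS⟩ :=
        ih _ (by
          subst hn
          refine Set.ncard_lt_ncard ?_ (Set.toFinite _)
          exact compl_lt_compl_iff_lt.2 (Set.ssubset_insert hv)) (insert e.snd S)
          (hS.mono (Set.subset_insert _ _)) rfl
      have hab : a ≠ b := by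
        rintro rfl
        exact hd a p.end_mem_support q.end_mem_support
      by_cases hav' : a = e.snd
      · have hbS : b ∈ S := hb.resolve_left fun h => hab (hav'.trans h.symm)
        obtain ⟨c, hc, hcb⟩ := hS.exists_ne b
        subst hav'
        exact hasDisjointPathsTo_of_insert hav p q hq hbS hd
          (fun z hz hzS => hv (hpS z hz (Or.inr hzS) ▸ hzS))
          (fun z hz hzS => hqS z hz (Or.inr hzS)) hc hcb hw e.adj.symm
      · have haS : a ∈ S := ha.resolve_left hav'
        by_cases hbv : b = e.snd
        · obtain ⟨c, hc, hcb⟩ := hS.exists_ne a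
          subst hbv
          exact (hasDisjointPathsTo_of_insert hav q p hp haS (fun z hz hz' => hd z hz' hz)
            (fun z hz hzS => hv (hqS z hz (Or.inr hzS) ▸ hzS))
            (fun z hz hzS => hpS z hz (Or.inr hzS)) hc hcb hw e.adj.symm).symm
        · exact ⟨a, b, p, q, hp, hq, haS, hb.resolve_left hbv, hd,
            fun z hz hzS => hpS z hz (Or.inr hzS), fun z hz hzS => hqS z hz (Or.inr hzS)⟩

/-- Disjoint paths starting in `s` and in `t` do not use the edge `{s, t}`. -/
theorem HasDisjointPathsTo.of_add_edge {G' : SimpleGraph V} {s t : V} {S : Set V}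
    (hG' : ∀ x y : V, G'.Adj x y ↔ (G.Adj x y ∨ (x = s ∧ y = t) ∨ (x = t ∧ y = s)))
    (h : G'.HasDisjointPathsTo s t S) : G.HasDisjointPathsTo s t S := by
  obtain ⟨a, b, p, q, hp, hq, ha, hb, hd, hpS, hqS⟩ := h
  have hp' : ∀ e ∈ p.edges, e ∈ G.edgeSet := by
    intro e he
    induction e with
    | _ x y =>
      have h₁ := p.fst_mem_support_of_mem_edges he
      have h₂ := p.snd_mem_support_of_mem_edges he
      rcases (hG' x y).1 (p.adj_of_mem_edges he) with h | ⟨rfl, rfl⟩ | ⟨rfl, rfl⟩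
      · exact h
      · exact absurd q.start_mem_support (hd _ h₂)
      · exact absurd q.start_mem_support (hd _ h₁)
  have hq' : ∀ e ∈ q.edges, e ∈ G.edgeSet := by
    intro e he
    induction e with
    | _ x y =>
      have h₁ := q.fst_mem_support_of_mem_edges he
      have h₂ := q.snd_mem_support_of_mem_edges he
      rcases (hG' x y).1 (q.adj_of_mem_edges he) with h | ⟨rfl, rfl⟩ | ⟨rfl, rfl⟩
      · exact h
      · exact absurd h₁ (hd _ p.start_mem_support)
      · exact absurd h₂ (hd _ p.start_mem_support)
  exact ⟨a, b, p.transfer G hp', q.transfer G hq', hp.transfer hp', hq.transfer hq', ha, hb,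
    by simpa using hd, by simpa using hpS, by simpa using hqS⟩

/-- Any two vertices of `S` are joined by two paths inside `S` which cover `S` and meet only in
their ends, as is the case for the vertex set of a cycle. -/
def IsCyclic (G : SimpleGraph V) (S : Set V) : Prop :=
  ∀ a ∈ S, ∀ b ∈ S, a ≠ b → ∃ A B : G.Walk a b, A.IsPath ∧ B.IsPath ∧
    (∀ z, z ∈ S ↔ z ∈ A.support ∨ z ∈ B.support) ∧
    (∀ z ∈ A.support, z ∈ B.support → z = a ∨ z = b)

theorem Walk.IsCycle.isCyclic_support {v : V} {C : G.Walk v v} (hC : C.IsCycle) :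
    G.IsCyclic {z | z ∈ C.support} := by
  classical
  intro a ha b hb hab
  have hb' : b ∈ (C.rotate a ha).support := (Walk.mem_support_rotate_iff _ _ _).2 hb
  have hR := hC.rotate ha
  have hsup : ∀ z, z ∈ C.support ↔ z ∈ (C.rotate a ha).support :=
    fun z => (Walk.mem_support_rotate_iff _ _ _).symm
  generalize C.rotate a ha = R at hb' hR hsup
  have hspec := R.take_spec hb'
  have hA := hR.isPath_takeUntil hb'
  generalize R.takeUntil b hb' = A at hspec hA
  generalize R.dropUntil b hb' = B at hspec
  subst hspec
  have hB : B.IsPath := hR.isPath_of_append_right (Walk.not_nil_of_ne hab)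
  refine ⟨A, B.reverse, hA, hB.reverse, ?_, ?_⟩
  · intro z
    rw [Set.mem_ofPred_eq, hsup, Walk.mem_support_append_iff]
    simp
  · intro z hzA hzB
    rw [Walk.support_reverse, List.mem_reverse] at hzB
    by_contra! hz
    have hnd := hR.support_nodup
    rw [Walk.tail_support_append] at hnd
    rw [Walk.mem_support_iff] at hzA hzB
    exact List.disjoint_of_nodup_append hnd (hzA.resolve_left hz.1) (hzB.resolve_left hz.2)

/-- A path inside `S` extends along disjoint paths that meet `S` only in its ends. -/
theorem exists_splice {S : Finset V} {u a b w : V} {p : G.Walk u a} {q : G.Walk b w}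
    {A : G.Walk a b} (hp : p.IsPath) (hq : q.IsPath) (hA : A.IsPath)
    (hd : ∀ z ∈ p.support, z ∉ q.support) (hpS : ∀ z ∈ p.support, z ∈ S → z = a)
    (hqS : ∀ z ∈ q.support, z ∈ S → z = b) (hAS : ∀ z ∈ A.support, z ∈ S) :
    ∃ P : G.Walk u w, P.IsPath ∧ (∀ z ∈ S, z ∈ P.support ↔ z ∈ A.support) ∧
      ∀ z ∉ S, z ∈ P.support ↔ z ∈ p.support ∨ z ∈ q.support := by
  refine ⟨p.append (A.append q), hp.append_of_meet (hA.append_of_meet hq ?_) ?_, ?_, ?_⟩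
  · exact fun z hz hzq => hqS z hzq (hAS z hz)
  · intro z hz hz'
    rw [Walk.mem_support_append_iff] at hz'
    exact hz'.elim (fun h => hpS z hz (hAS z h)) fun h => absurd h (hd z hz)
  · intro z hz
    simp only [Walk.mem_support_append_iff]
    refine ⟨?_, fun h => Or.inr (Or.inl h)⟩
    rintro (h | h | h)
    · rw [hpS z h hz]
      exact A.start_mem_support
    · exact h
    · rw [hqS z h hz]
      exact A.end_mem_support
  · intro z hz
    have := fun h => hz (hAS z h)
    simp only [Walk.mem_support_append_iff]
    tauto

section Traversal

variable [DecidableEq V]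

/-- Disjoint paths to the vertex set of a long cycle extend to two paths running through the two
arcs of the cycle. -/
theorem IsCyclic.exists_two_traversals {ℓ : ℕ} (hℓ : 1 ≤ ℓ) {S : Finset V}
    (hS : G.IsCyclic (S : Set V)) (hcard : 4 * ℓ ≤ S.card)
    {u a b w : V} {p : G.Walk u a} {q : G.Walk b w} (hp : p.IsPath) (hq : q.IsPath)
    (ha : a ∈ S) (hb : b ∈ S)
    (hd : ∀ z ∈ p.support, z ∉ q.support) (hpS : ∀ z ∈ p.support, z ∈ S → z = a)
    (hqS : ∀ z ∈ q.support, z ∈ S → z = b) :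
    ∃ P₁ P₂ : G.Walk u w, P₁.IsPath ∧ P₂.IsPath ∧
      2 * ℓ ≤ (symmDiff P₁.support.toFinset P₂.support.toFinset ∩ S).card ∧
      2 * ℓ + 1 ≤ (P₁.support.toFinset ∩ S).card ∧
      (∀ z ∉ S, z ∈ P₁.support ↔ z ∈ p.support ∨ z ∈ q.support) ∧
      (∀ z ∉ S, z ∈ P₂.support ↔ z ∈ p.support ∨ z ∈ q.support) := by
  have hab : a ≠ b := by
    rintro rfl
    exact hd a p.end_mem_support q.start_mem_support
  obtain ⟨A, B, hA, hB, hcover, hmeet⟩ := hS a ha b hb hab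
  wlog hAB : B.support.toFinset.card ≤ A.support.toFinset.card generalizing A B
  · exact this B A hB hA (fun z => (hcover z).trans or_comm) (fun z h h' => hmeet z h' h)
      (le_of_not_ge hAB)
  obtain ⟨P₁, hP₁, hP₁S, hP₁'⟩ := exists_splice (S := S) hp hq hA hd hpS hqS
    fun z hz => (hcover z).2 (Or.inl hz)
  obtain ⟨P₂, hP₂, hP₂S, hP₂'⟩ := exists_splice (S := S) hp hq hB hd hpS hqS
    fun z hz => (hcover z).2 (Or.inr hz)
  have hcover' : ∀ z, z ∈ S ↔ z ∈ A.support ∨ z ∈ B.support := hcover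
  have hU : A.support.toFinset ∪ B.support.toFinset = S := by
    ext z
    simp [hcover']
  have hI : A.support.toFinset ∩ B.support.toFinset = {a, b} := by
    ext z
    simp only [Finset.mem_inter, List.mem_toFinset, Finset.mem_insert, Finset.mem_singleton]
    refine ⟨fun h => hmeet z h.1 h.2, ?_⟩
    rintro (rfl | rfl) <;> simp
  have hsum := Finset.card_union_add_card_inter A.support.toFinset B.support.toFinset
  rw [hU, hI, Finset.card_pair hab] at hsum
  refine ⟨P₁, P₂, hP₁, hP₂, ?_, ?_, hP₁', hP₂'⟩
  · have hsub : S \ {a, b} ⊆ symmDiff P₁.support.toFinset P₂.support.toFinset ∩ S := by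
      intro z hz
      rw [Finset.mem_sdiff] at hz
      have h₁ := hP₁S z hz.1
      have h₂ := hP₂S z hz.1
      have h₃ := (hcover' z).1 hz.1
      have h₄ := hmeet z
      have h₅ := hz.2
      simp only [Finset.mem_insert, Finset.mem_singleton] at h₅
      simp only [Finset.mem_inter, Finset.mem_symmDiff, List.mem_toFinset]
      tauto
    have h₁ := Finset.card_le_card hsub
    have h₂ := Finset.le_card_sdiff {a, b} S
    rw [Finset.card_pair hab] at h₂
    lia
  · have hsub : A.support.toFinset ⊆ P₁.support.toFinset ∩ S := by
      intro z hz
      rw [List.mem_toFinset] at hz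
      have hzS := (hcover' z).2 (Or.inl hz)
      simp [hP₁S z hzS, hz, hzS]
    have h₁ := Finset.card_le_card hsub
    lia

/-- There are three `s`-`t` paths whose vertex sets pairwise differ in at least `k` vertices. -/
def HasThreeDiversePaths (G : SimpleGraph V) (k : ℕ) (s t : V) : Prop :=
  ∃ p₁ p₂ p₃ : G.Walk s t, p₁.IsPath ∧ p₂.IsPath ∧ p₃.IsPath ∧
    k ≤ (symmDiff p₁.support.toFinset p₂.support.toFinset).card ∧
    k ≤ (symmDiff p₁.support.toFinset p₃.support.toFinset).card ∧
    k ≤ (symmDiff p₂.support.toFinset p₃.support.toFinset).card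

theorem HasThreeDiversePaths.symm {k : ℕ} {s t : V} (h : G.HasThreeDiversePaths k s t) :
    G.HasThreeDiversePaths k t s := by
  obtain ⟨p₁, p₂, p₃, h₁, h₂, h₃, h⟩ := h
  refine ⟨p₁.reverse, p₂.reverse, p₃.reverse, h₁.reverse, h₂.reverse, h₃.reverse, ?_⟩
  simpa only [Walk.support_reverse, List.toFinset_reverse] using h

theorem hasThreeDiversePaths_of_le_card_inter {k : ℕ} {s t : V} {T : Finset V}
    {P₁ P₂ Q : G.Walk s t} (hP₁ : P₁.IsPath) (hP₂ : P₂.IsPath) (hQ : Q.IsPath)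
    (hP : k ≤ (symmDiff P₁.support.toFinset P₂.support.toFinset).card)
    (h₁ : (P₁.support.toFinset ∩ T).card ≤ 1) (h₂ : (P₂.support.toFinset ∩ T).card ≤ 1)
    (hQT : k + 1 ≤ (Q.support.toFinset ∩ T).card) : G.HasThreeDiversePaths k s t := by
  have key : ∀ P : Finset V, (P ∩ T).card ≤ 1 → k ≤ (symmDiff P Q.support.toFinset).card := by
    intro P hPT
    have hsub : (Q.support.toFinset ∩ T) \ (P ∩ T) ⊆ symmDiff P Q.support.toFinset := by
      intro z hz
      simp only [Finset.mem_sdiff, Finset.mem_inter] at hz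
      simp only [Finset.mem_symmDiff]
      tauto
    have := Finset.card_le_card hsub
    have := Finset.le_card_sdiff (P ∩ T) (Q.support.toFinset ∩ T)
    lia
  exact ⟨P₁, P₂, Q, hP₁, hP₂, hQ, hP, key _ h₁, key _ h₂⟩

variable {ℓ : ℕ} {S T : Finset V} {s t a b : V} {p : G.Walk s a} {q : G.Walk b t}

/-- The case in which both paths to the first cycle pass through the second cycle. -/
theorem hasThreeDiversePaths_of_both_meet (hℓ : 1 ≤ ℓ) (hS : G.IsCyclic (S : Set V))
    (hScard : 4 * ℓ ≤ S.card) (hT : G.IsCyclic (T : Set V)) (hTcard : 4 * ℓ ≤ T.card)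
    (hST : Disjoint S T) (hp : p.IsPath) (hq : q.IsPath) (ha : a ∈ S) (hb : b ∈ S)
    (hd : ∀ z ∈ p.support, z ∉ q.support) (hpS : ∀ z ∈ p.support, z ∈ S → z = a)
    (hqS : ∀ z ∈ q.support, z ∈ S → z = b)
    (hpT : ∃ z ∈ p.support, z ∈ T) (hqT : ∃ z ∈ q.support, z ∈ T) :
    G.HasThreeDiversePaths (2 * ℓ) s t := by
  rw [Finset.disjoint_left] at hST
  obtain ⟨Q, -, hQ, -, -, hQS, -, -⟩ :=
    hS.exists_two_traversals hℓ hScard hp hq ha hb hd hpS hqS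
  obtain ⟨f, p₁, p₂, hp₁, -, hf, hpsup, hpmeet, hpfirst⟩ := hp.exists_split_at_first (T : Set V) hpT
  obtain ⟨g, q₁, q₂, hq₁, -, hg, hqsup, hqmeet, hqfirst⟩ :=
    hq.reverse.exists_split_at_first (T : Set V) (by simpa using hqT)
  simp only [Walk.support_reverse, List.mem_reverse] at hqsup
  have hp₁S : ∀ z ∈ p₁.support, z ∉ S := by
    intro z hz hzS
    have hza := hpS z ((hpsup z).2 (Or.inl hz)) hzS
    subst hza
    have hzf := hpmeet z hz p₂.end_mem_support
    subst hzf
    exact hST hzS hf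
  have hq₁S : ∀ z ∈ q₁.support, z ∉ S := by
    intro z hz hzS
    have hzb := hqS z ((hqsup z).2 (Or.inl hz)) hzS
    subst hzb
    have hzg := hqmeet z hz q₂.end_mem_support
    subst hzg
    exact hST hzS hg
  obtain ⟨P₁, P₂, hP₁, hP₂, hdiff, -, hP₁T, hP₂T⟩ :=
    hT.exists_two_traversals hℓ hTcard hp₁ hq₁.reverse hf hg
      (fun z hz hz' => hd z ((hpsup z).2 (Or.inl hz)) ((hqsup z).2 (Or.inl (by simpa using hz'))))
      hpfirst (by simpa using hqfirst)
  simp only [Walk.support_reverse, List.mem_reverse] at hP₁T hP₂T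
  refine hasThreeDiversePaths_of_le_card_inter (T := S) hP₁ hP₂ hQ
    (hdiff.trans (Finset.card_le_card Finset.inter_subset_left)) ?_ ?_ hQS
  · rw [Finset.card_eq_zero.2]
    · simp
    · ext z
      have h₁ := hP₁T z
      have h₂ := hp₁S z
      have h₃ := hq₁S z
      have h₄ : z ∈ S → z ∉ T := fun h => hST h
      simp only [Finset.mem_inter, List.mem_toFinset, Finset.notMem_empty, iff_false]
      tauto
  · rw [Finset.card_eq_zero.2]
    · simp
    · ext z
      have h₁ := hP₂T z
      have h₂ := hp₁S z
      have h₃ := hq₁S z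
      have h₄ : z ∈ S → z ∉ T := fun h => hST h
      simp only [Finset.mem_inter, List.mem_toFinset, Finset.notMem_empty, iff_false]
      tauto

/-- The case in which only one path to the first cycle meets the second cycle, and does so more
than once. -/
theorem hasThreeDiversePaths_of_one_meets (hℓ : 1 ≤ ℓ) (hS : G.IsCyclic (S : Set V))
    (hScard : 4 * ℓ ≤ S.card) (hT : G.IsCyclic (T : Set V)) (hTcard : 4 * ℓ ≤ T.card)
    (hST : Disjoint S T) (hp : p.IsPath) (hq : q.IsPath) (ha : a ∈ S) (hb : b ∈ S)
    (hd : ∀ z ∈ p.support, z ∉ q.support) (hpS : ∀ z ∈ p.support, z ∈ S → z = a)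
    (hqS : ∀ z ∈ q.support, z ∈ S → z = b)
    (hpT : 1 < (p.support.toFinset ∩ T).card) (hqT : ∀ z ∈ q.support, z ∉ T) :
    G.HasThreeDiversePaths (2 * ℓ) s t := by
  rw [Finset.disjoint_left] at hST
  obtain ⟨x, hx, y, hy, hxy⟩ := Finset.one_lt_card.1 hpT
  simp only [Finset.mem_inter, List.mem_toFinset] at hx hy
  obtain ⟨f, p₁, p₂, hp₁, hp₂, hf, hsup, hmeet, hfirst⟩ :=
    hp.exists_split_at_first (T : Set V) ⟨x, hx⟩
  have hex : ∃ z ∈ p₂.support, z ∈ T ∧ z ≠ f := by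
    by_contra! h
    have key : ∀ z ∈ p.support, z ∈ T → z = f := fun z hz hzT =>
      ((hsup z).1 hz).elim (fun h' => hfirst z h' hzT) fun h' => h z h' hzT
    exact hxy ((key x hx.1 hx.2).trans (key y hy.1 hy.2).symm)
  obtain ⟨g, r₁, r₂, hr₁, -, hg, hrsup, hrmeet, hrfirst⟩ :=
    hp₂.reverse.exists_split_at_first {z | z ∈ T ∧ z ≠ f} (by simpa using hex)
  simp only [Walk.support_reverse, List.mem_reverse] at hrsup
  have hfr : f ∉ r₁.support := fun h => hg.2 (hrmeet f h r₂.end_mem_support).symm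
  have hr₁p : ∀ z ∈ r₁.support, z ∈ p.support := fun z hz =>
    (hsup z).2 (Or.inr ((hrsup z).2 (Or.inl hz)))
  obtain ⟨R₁, R₂, hR₁, hR₂, hdiff, -, hR₁T, hR₂T⟩ :=
    hT.exists_two_traversals hℓ hTcard hp₁ hr₁.reverse hf hg.1
      (by
        intro z hz hz'
        rw [Walk.support_reverse, List.mem_reverse] at hz'
        have := hmeet z hz ((hrsup z).2 (Or.inl hz'))
        exact hfr (this ▸ hz'))
      hfirst
      (by
        intro z hz hzT
        rw [Walk.support_reverse, List.mem_reverse] at hz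
        exact hrfirst z hz ⟨hzT, fun h => hfr (h ▸ hz)⟩)
  have hsub : ∀ R : G.Walk s a,
      (∀ z ∉ T, z ∈ R.support ↔ z ∈ p₁.support ∨ z ∈ r₁.reverse.support) →
      ∀ z ∈ R.support, z ∉ T → z ∈ p.support := by
    intro R hR z hz hzT
    rw [hR z hzT, Walk.support_reverse, List.mem_reverse] at hz
    exact hz.elim (fun h => (hsup z).2 (Or.inl h)) (hr₁p z)
  have hdR : ∀ R : G.Walk s a, (∀ z ∈ R.support, z ∉ T → z ∈ p.support) →
      ∀ z ∈ R.support, z ∉ q.support :=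
    fun R hR z hz hzq => hd z (hR z hz (hqT z hzq)) hzq
  have hRS : ∀ R : G.Walk s a, (∀ z ∈ R.support, z ∉ T → z ∈ p.support) →
      ∀ z ∈ R.support, z ∈ S → z = a :=
    fun R hR z hz hzS => hpS z (hR z hz (hST hzS)) hzS
  obtain ⟨P₁, P₂, hP₁, hP₂, hP, -, hP₁S, hP₂S⟩ := hS.exists_two_traversals hℓ hScard hR₁ hq ha hb
    (hdR R₁ (hsub R₁ hR₁T)) (hRS R₁ (hsub R₁ hR₁T)) hqS
  obtain ⟨P₃, -, hP₃, -, -, -, hP₃S, -⟩ := hS.exists_two_traversals hℓ hScard hR₂ hq ha hb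
    (hdR R₂ (hsub R₂ hR₂T)) (hRS R₂ (hsub R₂ hR₂T)) hqS
  have key : ∀ P : G.Walk s t, (∀ z ∉ S, z ∈ P.support ↔ z ∈ R₁.support ∨ z ∈ q.support) →
      2 * ℓ ≤ (symmDiff P.support.toFinset P₃.support.toFinset).card := by
    intro P hPS
    refine hdiff.trans (Finset.card_le_card fun z hz => ?_)
    simp only [Finset.mem_inter, Finset.mem_symmDiff, List.mem_toFinset] at hz ⊢
    have hzS : z ∉ S := fun h => hST h hz.2
    have h₁ := hPS z hzS
    have h₂ := hP₃S z hzS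
    have h₃ := hqT z
    tauto
  exact ⟨P₁, P₂, P₃, hP₁, hP₂, hP₃, hP.trans (Finset.card_le_card Finset.inter_subset_left),
    key P₁ hP₁S, key P₂ hP₂S⟩

/-- Two disjoint long cycles, each linked to `s` and `t` by disjoint paths, yield three diverse
`s`-`t` paths. -/
theorem hasThreeDiversePaths_of_hasDisjointPathsTo (hℓ : 1 ≤ ℓ) (hS : G.IsCyclic (S : Set V))
    (hScard : 4 * ℓ ≤ S.card) (hT : G.IsCyclic (T : Set V)) (hTcard : 4 * ℓ ≤ T.card)
    (hST : Disjoint S T) (hlinkS : G.HasDisjointPathsTo s t (S : Set V))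
    (hlinkT : G.HasDisjointPathsTo s t (T : Set V)) : G.HasThreeDiversePaths (2 * ℓ) s t := by
  obtain ⟨a, b, p, q, hp, hq, ha, hb, hd, hpS, hqS⟩ := hlinkS
  have hd' : ∀ z ∈ p.support, z ∉ q.reverse.support := by simpa using hd
  have hqS' : ∀ z ∈ q.reverse.support, z ∈ S → z = b := by simpa using hqS
  have hunion : (p.support.toFinset ∪ q.support.toFinset) ∩ T =
      (p.support.toFinset ∩ T) ∪ (q.support.toFinset ∩ T) := Finset.union_inter_distrib_right _ _ _
  by_cases hone : ((p.support.toFinset ∪ q.support.toFinset) ∩ T).card ≤ 1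
  · obtain ⟨a', b', p', q', hp', hq', ha', hb', hd'', hpT, hqT⟩ := hlinkT
    obtain ⟨Q, -, hQ, -, -, hQT, -, -⟩ := hT.exists_two_traversals hℓ hTcard hp' hq'.reverse ha' hb'
      (by simpa using hd'') hpT (by simpa using hqT)
    obtain ⟨P₁, P₂, hP₁, hP₂, hP, -, hP₁S, hP₂S⟩ :=
      hS.exists_two_traversals hℓ hScard hp hq.reverse ha hb hd' hpS hqS'
    have key : ∀ P : G.Walk s t,
        (∀ z ∉ S, z ∈ P.support ↔ z ∈ p.support ∨ z ∈ q.reverse.support) →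
        (P.support.toFinset ∩ T).card ≤ 1 := by
      intro P hPS
      refine (Finset.card_le_card fun z hz => ?_).trans hone
      simp only [Finset.mem_inter, Finset.mem_union, List.mem_toFinset] at hz ⊢
      have := (hPS z fun h => Finset.disjoint_left.1 hST h hz.2).1 hz.1
      rw [Walk.support_reverse, List.mem_reverse] at this
      exact ⟨this, hz.2⟩
    exact hasThreeDiversePaths_of_le_card_inter hP₁ hP₂ hQ
      (hP.trans (Finset.card_le_card Finset.inter_subset_left)) (key P₁ hP₁S) (key P₂ hP₂S) hQT
  · rw [not_le, hunion] at hone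
    by_cases hpT : ∃ z ∈ p.support, z ∈ T
    · by_cases hqT : ∃ z ∈ q.support, z ∈ T
      · exact hasThreeDiversePaths_of_both_meet hℓ hS hScard hT hTcard hST hp hq.reverse ha hb hd'
          hpS hqS' hpT (by simpa using hqT)
      · push Not at hqT
        have hempty : q.support.toFinset ∩ T = ∅ := by
          ext z
          simpa using hqT z
        rw [hempty, Finset.union_empty] at hone
        exact hasThreeDiversePaths_of_one_meets hℓ hS hScard hT hTcard hST hp hq.reverse ha hb hd'
          hpS hqS' hone (by simpa using hqT)
    · push Not at hpT
      have hempty : p.support.toFinset ∩ T = ∅ := by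
        ext z
        simpa using hpT z
      rw [hempty, Finset.empty_union] at hone
      exact (hasThreeDiversePaths_of_one_meets hℓ hS hScard hT hTcard hST hq hp.reverse hb ha
        (by simpa using fun z hz hz' => hd z hz' hz) hqS (by simpa using hpS) hone
        (by simpa using hpT)).symm

end Traversal

end SimpleGraph


/-- if adding the edge `{s, t}` to a finite simple graph `G` yields
a 2-connected graph `G'` and `G` contains two vertex-disjoint cycles, each with at
least `4ℓ` vertices, then there are three `s`-`t` paths in `G` whose vertex sets
have pairwise symmetric differences of size at least `2ℓ`. -/
theorem three_diverse_st_paths_from_two_disjoint_long_cycles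
    {V : Type*} [Fintype V] [DecidableEq V] (ℓ : ℕ) (hℓ : 1 ≤ ℓ)
    (G G' : SimpleGraph V) (s t : V) (hst : s ≠ t)
    (hG' : ∀ x y : V, G'.Adj x y ↔
      (G.Adj x y ∨ (x = s ∧ y = t) ∨ (x = t ∧ y = s)))
    (hcard : 3 ≤ Fintype.card V)
    (hconn : G'.Connected)
    (h2conn : ∀ v : V, (G'.induce {u : V | u ≠ v}).Connected)
    (v₁ v₂ : V) (C₁ : G.Walk v₁ v₁) (C₂ : G.Walk v₂ v₂)
    (hC₁ : C₁.IsCycle) (hC₂ : C₂.IsCycle)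
    (hdisj : ∀ x : V, x ∈ C₁.support → x ∉ C₂.support)
    (hlen₁ : 4 * ℓ ≤ C₁.support.toFinset.card)
    (hlen₂ : 4 * ℓ ≤ C₂.support.toFinset.card) :
    ∃ p₁ p₂ p₃ : G.Walk s t, p₁.IsPath ∧ p₂.IsPath ∧ p₃.IsPath ∧
      2 * ℓ ≤ (symmDiff p₁.support.toFinset p₂.support.toFinset).card ∧
      2 * ℓ ≤ (symmDiff p₁.support.toFinset p₃.support.toFinset).card ∧
      2 * ℓ ≤ (symmDiff p₂.support.toFinset p₃.support.toFinset).card := by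
  have hav : ∀ v x y : V, x ≠ v → y ≠ v → ∃ r : G'.Walk x y, v ∉ r.support := by
    intro v x y hx hy
    obtain ⟨r⟩ := (h2conn v).preconnected ⟨x, hx⟩ ⟨y, hy⟩
    have hr : v ∉ (r.map (SimpleGraph.Embedding.induce {u : V | u ≠ v}).toHom).support := by
      rw [SimpleGraph.Walk.support_map, List.mem_map]
      rintro ⟨z, -, hz⟩
      exact z.2 hz
    exact ⟨_, hr⟩
  have hlink : ∀ S : Finset V, 4 * ℓ ≤ S.card → G.HasDisjointPathsTo s t (S : Set V) :=
    fun S hS => (SimpleGraph.hasDisjointPathsTo_of_biconnected hconn.preconnected hav hst _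
      (Finset.one_lt_card_iff_nontrivial.1 (by lia))).of_add_edge hG'
  exact SimpleGraph.hasThreeDiversePaths_of_hasDisjointPathsTo hℓ
    (by simpa using hC₁.isCyclic_support) hlen₁ (by simpa using hC₂.isCyclic_support) hlen₂
    (Finset.disjoint_left.2 (by simpa using hdisj)) (hlink _ hlen₁) (hlink _ hlen₂)
end
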